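/- For every positive integer n, the crossing number of the complete bipartite graph K_{5,n} equals Z(5,n). -/

import Mathlib

open SimpleGraph

variable {V : Type*}

/-- A drawing of a simple graph in the plane: an injective placement of the
vertices in `ℝ²` together with, for each edge, a continuous arc joining the
positions of its endpoints (parametrised compatibly in both directions),
such that no arc passes through the position of a vertex other than its
endpoints. -/
structure Drawing (G : SimpleGraph V) where
  pos : V → ℝ × ℝ
  pos_inj : Function.Injective pos
  arc : V → V → ℝ → ℝ × ℝ
  arc_cont : ∀ ⦃a b⦄, G.Adj a b → ContinuousOn (arc a b) (Set.Icc 0 1)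
  arc_zero : ∀ ⦃a b⦄, G.Adj a b → arc a b 0 = pos a
  arc_one : ∀ ⦃a b⦄, G.Adj a b → arc a b 1 = pos b
  arc_symm : ∀ ⦃a b⦄, G.Adj a b → ∀ t, arc b a t = arc a b (1 - t)
  arc_avoid : ∀ ⦃a b⦄, G.Adj a b → ∀ c, c ≠ a → c ≠ b →
      pos c ∉ arc a b '' Set.Icc 0 1

namespace Drawing

variable {G : SimpleGraph V} (D : Drawing G)

/-- The set of points of the plane used by the edge `e`. -/
def edgePoints (e : Sym2 V) : Set (ℝ × ℝ) :=
  {p | ∃ a b, e = s(a, b) ∧ G.Adj a b ∧ p ∈ D.arc a b '' Set.Icc 0 1}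

/-- The positions of the endpoints of an edge. -/
def ends (e : Sym2 V) : Set (ℝ × ℝ) := {p | ∃ a ∈ e, p = D.pos a}

/-- `p` is a crossing of the (distinct) edges `e` and `f` in the drawing `D`:
a common point of the two edges other than an endpoint. -/
def IsCrossing (e f : Sym2 V) (p : ℝ × ℝ) : Prop :=
  e ∈ G.edgeSet ∧ f ∈ G.edgeSet ∧ e ≠ f ∧
    p ∈ D.edgePoints e ∧ p ∈ D.edgePoints f ∧ p ∉ D.ends e ∧ p ∉ D.ends f

/-- The crossings between an edge of `A` and an edge of `B`: a crossing is
recorded as a point of the plane together with the unordered pair of edges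
crossing there. -/
def crossings (A B : Set (Sym2 V)) : Set ((ℝ × ℝ) × Sym2 (Sym2 V)) :=
  {q | ∃ e f, q.2 = s(e, f) ∧ e ∈ A ∧ f ∈ B ∧ D.IsCrossing e f q.1}

/-- `cr_D(A, B)`: the number of crossings between an edge of `A` and an
edge of `B`. -/
noncomputable def crBetween (A B : Set (Sym2 V)) : ℕ := Nat.card (D.crossings A B)

/-- `cr(D)`: the total number of crossings of the drawing `D`. -/
noncomputable def crNum : ℕ := D.crBetween G.edgeSet G.edgeSet

/-- A good drawing: no edge crosses itself (each arc is a simple arc),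
no two adjacent edges cross, no two edges cross more than once, and no three
edges cross at a common point. -/
structure IsGood : Prop where
  arc_inj : ∀ ⦃a b⦄, G.Adj a b → Set.InjOn (D.arc a b) (Set.Icc 0 1)
  adj_no_cross : ∀ e f : Sym2 V, (∃ a, a ∈ e ∧ a ∈ f) → ∀ p, ¬ D.IsCrossing e f p
  cross_once : ∀ e f : Sym2 V, {p | D.IsCrossing e f p}.Subsingleton
  no_triple : ∀ p, ∀ e f g : Sym2 V, e ≠ f → e ≠ g → f ≠ g →
      ¬ (D.IsCrossing e f p ∧ D.IsCrossing f g p ∧ D.IsCrossing e g p)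

end Drawing

/-- The crossing number of a graph: the minimum number of crossings among
all good drawings of `G` in the plane. -/
noncomputable def crossingNumber (G : SimpleGraph V) : ℕ :=
  sInf {n | ∃ D : Drawing G, D.IsGood ∧ D.crNum = n}

/-- The Zarankiewicz function `Z(m,n) = ⌊m/2⌋⌊(m-1)/2⌋⌊n/2⌋⌊(n-1)/2⌋`. -/
def Z (m n : ℕ) : ℕ := m / 2 * ((m - 1) / 2) * (n / 2) * ((n - 1) / 2)

/-- The complete bipartite graph `K_{a,b}`. -/
abbrev bipK (a b : ℕ) : SimpleGraph (Fin a ⊕ Fin b) :=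
  completeBipartiteGraph (Fin a) (Fin b)

/-- The complete tripartite graph `K_{a,b,c}`. -/
abbrev triK (a b c : ℕ) : SimpleGraph (Σ i : Fin 3, ![Fin a, Fin b, Fin c] i) :=
  completeMultipartiteGraph ![Fin a, Fin b, Fin c]

/-- The complete 4-partite graph `K_{a,b,c,d}`. -/
abbrev quadK (a b c d : ℕ) : SimpleGraph (Σ i : Fin 4, ![Fin a, Fin b, Fin c, Fin d] i) :=
  completeMultipartiteGraph ![Fin a, Fin b, Fin c, Fin d]

/-- `E(V₁, V₂)`: the set of pairs `{v₁, v₂}` with `v₁ ∈ V₁` and `v₂ ∈ V₂`. -/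
def pairEdges {α : Type*} (V₁ V₂ : Set α) : Set (Sym2 α) :=
  {e | ∃ a ∈ V₁, ∃ b ∈ V₂, e = s(a, b)}



namespace K5n

set_option linter.unusedSectionVars false

section Counting

variable {ι : Type*} [DecidableEq ι]

/-- Row sum. -/
def rowS (C : ι → ι → ℕ) (S : Finset ι) (i : ι) : ℕ := ∑ j ∈ S, C i j

/-- Twice the total. -/
def totS (C : ι → ι → ℕ) (S : Finset ι) : ℕ := ∑ i ∈ S, rowS C S i

lemma rowS_insert (C : ι → ι → ℕ) {S : Finset ι} {a : ι} (ha : a ∉ S) (i : ι) :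
    rowS C (insert a S) i = C i a + rowS C S i := by
  simp [rowS, Finset.sum_insert ha]

lemma totS_insert (C : ι → ι → ℕ) (hs : ∀ i j, C i j = C j i) (hd : ∀ i, C i i = 0)
    {S : Finset ι} {a : ι} (ha : a ∉ S) :
    totS C (insert a S) = totS C S + 2 * rowS C S a := by
  unfold totS
  rw [Finset.sum_insert ha, rowS_insert C ha, hd]
  have : ∑ i ∈ S, rowS C (insert a S) i = ∑ i ∈ S, (C a i + rowS C S i) :=
    Finset.sum_congr rfl fun i _ => by rw [rowS_insert C ha, hs i a]
  rw [this, Finset.sum_add_distrib]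
  unfold rowS
  omega

lemma totS_erase (C : ι → ι → ℕ) (hs : ∀ i j, C i j = C j i) (hd : ∀ i, C i i = 0)
    {S : Finset ι} {a : ι} (ha : a ∈ S) :
    totS C S = totS C (S.erase a) + 2 * rowS C S a := by
  conv_lhs => rw [← Finset.insert_erase ha]
  rw [totS_insert C hs hd (Finset.notMem_erase a S)]
  have : rowS C S a = rowS C (S.erase a) a := by
    conv_lhs => rw [← Finset.insert_erase ha]
    rw [rowS_insert C (Finset.notMem_erase a S), hd, zero_add]
  rw [this]

lemma totS_even4 (C : ι → ι → ℕ) (hs : ∀ i j, C i j = C j i) (hd : ∀ i, C i i = 0)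
    (S : Finset ι) (he : ∀ i ∈ S, ∀ j ∈ S, Even (C i j)) : 4 ∣ totS C S := by
  induction S using Finset.induction_on with
  | empty => simp [totS]
  | insert a S ha ih =>
    rw [totS_insert C hs hd ha]
    have h1 := ih fun i hi j hj => he i (Finset.mem_insert_of_mem hi) j (Finset.mem_insert_of_mem hj)
    have h2 : 2 ∣ rowS C S a := Finset.dvd_sum fun j hj =>
      (he a (Finset.mem_insert_self _ _) j (Finset.mem_insert_of_mem hj)).two_dvd
    omega

lemma rowS_union (C : ι → ι → ℕ) {P Q : Finset ι} (h : Disjoint P Q) (i : ι) :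
    rowS C (P ∪ Q) i = rowS C P i + rowS C Q i := by
  simp [rowS, Finset.sum_union h]

lemma sum_odd_mod (f : ι → ℕ) (S : Finset ι) (h : ∀ i ∈ S, f i % 2 = 1) :
    (∑ i ∈ S, f i) % 2 = S.card % 2 := by
  induction S using Finset.induction_on with
  | empty => simp
  | insert a S ha ih =>
    have := ih fun i hi => h i (Finset.mem_insert_of_mem hi)
    have := h a (Finset.mem_insert_self _ _)
    rw [Finset.sum_insert ha, Finset.card_insert_of_notMem ha]; omega

lemma sum_even_mod (f : ι → ℕ) (S : Finset ι) (h : ∀ i ∈ S, f i % 2 = 0) :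
    (∑ i ∈ S, f i) % 2 = 0 := by
  have : 2 ∣ ∑ i ∈ S, f i := Finset.dvd_sum fun i hi => by have := h i hi; omega
  omega

lemma totS_union (C : ι → ι → ℕ) (hs : ∀ i j, C i j = C j i)
    {P Q : Finset ι} (h : Disjoint P Q) :
    totS C (P ∪ Q) = totS C P + totS C Q + 2 * ∑ i ∈ P, rowS C Q i := by
  unfold totS
  rw [Finset.sum_union h]
  simp only [rowS_union C h, Finset.sum_add_distrib]
  have : ∑ i ∈ Q, rowS C P i = ∑ i ∈ P, rowS C Q i := by
    unfold rowS
    rw [Finset.sum_comm]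
    exact Finset.sum_congr rfl fun i _ => Finset.sum_congr rfl fun j _ => hs _ _
  omega

/-- The critical configuration is excluded. -/
def NoConf (C : ι → ι → ℕ) : Prop :=
  ∀ (u v : ι) (Q : Finset ι), u ≠ v → u ∉ Q → v ∉ Q →
    (∀ w ∈ Q, C u w = 1 ∧ C v w = 1) → (∀ w ∈ Q, ∀ w' ∈ Q, w ≠ w' → C w w' = 2) →
    3 ≤ Q.card → Odd Q.card → C u v + 1 = Q.card → False

lemma crit (C : ι → ι → ℕ) (hs : ∀ i j, C i j = C j i) (hd : ∀ i, C i i = 0)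
    (hn : NoConf C) (P Q : Finset ι) (h : Disjoint P Q) (k : ℕ) (hk : 2 ≤ k)
    (hc : (P ∪ Q).card = 2 * k + 1) (hP : Even P.card)
    (hpos : ∀ i ∈ P ∪ Q, ∀ j ∈ P ∪ Q, i ≠ j → C i j ≠ 0)
    (hPe : ∀ i ∈ P, ∀ j ∈ P, C i j % 2 = 0) (hQe : ∀ i ∈ Q, ∀ j ∈ Q, C i j % 2 = 0)
    (hPQ : ∀ i ∈ P, ∀ j ∈ Q, C i j % 2 = 1)
    (hT : totS C (P ∪ Q) + 4 = 8 * k ^ 2)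
    (hrow : ∀ i ∈ P ∪ Q, rowS C (P ∪ Q) i ≤ 4 * k - 2) : False := by
  have hcard : P.card + Q.card = 2 * k + 1 := by rw [← hc, Finset.card_union_of_disjoint h]
  have hsum : ∑ i ∈ P ∪ Q, (4 * k - 2 - rowS C (P ∪ Q) i) = 2 := by
    have h1 : ∑ i ∈ P ∪ Q, (4 * k - 2 - rowS C (P ∪ Q) i) + totS C (P ∪ Q) =
        ∑ i ∈ P ∪ Q, (4 * k - 2) := by
      unfold totS
      rw [← Finset.sum_add_distrib]
      exact Finset.sum_congr rfl fun i hi => Nat.sub_add_cancel (hrow i hi)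
    rw [Finset.sum_const, hc, smul_eq_mul] at h1
    have h2 : (2 * k + 1) * (4 * k - 2) + 2 = 8 * k ^ 2 := by
      obtain ⟨m, rfl⟩ := Nat.exists_eq_add_of_le hk
      have : 4 * (2 + m) - 2 = 4 * m + 6 := by omega
      rw [this]; ring
    omega
  rw [Finset.sum_union h] at hsum
  have hPo : ∀ u ∈ P, 1 ≤ 4 * k - 2 - rowS C (P ∪ Q) u := by
    intro u hu
    have h1 := hrow u (Finset.mem_union_left _ hu)
    have h2 : rowS C (P ∪ Q) u % 2 = 1 := by
      rw [rowS_union C h]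
      have a1 : rowS C P u % 2 = 0 := sum_even_mod _ _ (hPe u hu)
      have a2 : rowS C Q u % 2 = Q.card % 2 := sum_odd_mod _ _ (hPQ u hu)
      have : P.card % 2 = 0 := Nat.even_iff.mp hP
      omega
    omega
  have hPsum : P.card ≤ ∑ u ∈ P, (4 * k - 2 - rowS C (P ∪ Q) u) := by
    simpa using Finset.sum_le_sum hPo
  have hP2 : P.card % 2 = 0 := Nat.even_iff.mp hP
  have hge2 : ∀ w ∈ Q, 2 * (Q.card - 1) ≤ rowS C Q w := by
    intro w hw
    unfold rowS
    rw [← Finset.add_sum_erase _ _ hw, hd, zero_add, ← Finset.card_erase_of_mem hw, mul_comm,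
      ← smul_eq_mul, ← Finset.sum_const]
    refine Finset.sum_le_sum fun j hj => ?_
    have hj' := Finset.mem_erase.mp hj
    have := hpos w (Finset.mem_union_right _ hw) j (Finset.mem_union_right _ hj'.2) hj'.1.symm
    have := hQe w hw j hj'.2
    omega
  rcases Nat.eq_zero_or_pos P.card with h0 | hp
  · have : Q.Nonempty := Finset.card_pos.mp (by omega)
    obtain ⟨w, hw⟩ := this
    have h1 := hrow w (Finset.mem_union_right _ hw)
    rw [rowS_union C h] at h1
    have := hge2 w hw
    omega
  have hp2 : P.card = 2 := by omega
  have hQ0 : ∑ w ∈ Q, (4 * k - 2 - rowS C (P ∪ Q) w) = 0 := by omega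
  obtain ⟨u, v, huv, rfl⟩ := Finset.card_eq_two.mp hp2
  have huQ : u ∉ Q := fun hh => Finset.disjoint_left.mp h (by simp) hh
  have hvQ : v ∉ Q := fun hh => Finset.disjoint_left.mp h (by simp) hh
  have hQc : Q.card = 2 * k - 1 := by omega
  have hw : ∀ w ∈ Q, C u w = 1 ∧ C v w = 1 ∧ rowS C Q w = 2 * (Q.card - 1) := by
    intro w hw
    have h1 := Finset.sum_eq_zero_iff.mp hQ0 w hw
    have h2 := hrow w (Finset.mem_union_right _ hw)
    rw [rowS_union C h] at h1 h2
    have h3 : rowS C {u, v} w = C w u + C w v := by simp [rowS, Finset.sum_pair huv]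
    have h4 := hge2 w hw
    have h5 := hPQ u (by simp) w hw
    have h6 := hPQ v (by simp) w hw
    rw [hs w u, hs w v] at h3
    omega
  refine hn u v Q huv huQ hvQ (fun w h => ⟨(hw w h).1, (hw w h).2.1⟩) ?_ (by omega)
    (Nat.odd_iff.mpr (by omega)) ?_
  · intro w hwQ w' hw' hne
    have h1 := (hw w hwQ).2.2
    unfold rowS at h1
    rw [← Finset.add_sum_erase _ _ hwQ, hd, zero_add,
      ← Finset.card_erase_of_mem hwQ, mul_comm, ← smul_eq_mul, ← Finset.sum_const] at h1
    have h2 : ∀ j ∈ Q.erase w, 2 ≤ C w j := by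
      intro j hj
      have hj' := Finset.mem_erase.mp hj
      have := hpos w (Finset.mem_union_right _ hwQ) j (Finset.mem_union_right _ hj'.2) hj'.1.symm
      have := hQe w hwQ j hj'.2
      omega
    exact ((Finset.sum_eq_sum_iff_of_le h2).mp h1.symm w' (Finset.mem_erase.mpr ⟨hne.symm, hw'⟩)).symm
  · have hu := hPo u (by simp)
    have hv := hPo v (by simp)
    rw [Finset.sum_pair huv] at hsum
    have h1 := hrow u (by simp)
    have h3 : rowS C ({u, v} ∪ Q) u = C u v + Q.card := by
      rw [rowS_union C h]
      have : rowS C {u, v} u = C u v := by simp [rowS, Finset.sum_pair huv, hd]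
      rw [this]
      congr 1
      unfold rowS
      rw [Finset.sum_congr rfl fun w hwQ => (hw w hwQ).1]; simp
    omega

lemma sum_tot_erase (C : ι → ι → ℕ) (hs : ∀ i j, C i j = C j i) (hd : ∀ i, C i i = 0)
    (S : Finset ι) : ∑ i ∈ S, totS C (S.erase i) + 2 * totS C S = S.card * totS C S := by
  have h1 : ∑ i ∈ S, (totS C (S.erase i) + 2 * rowS C S i) = ∑ i ∈ S, totS C S :=
    Finset.sum_congr rfl fun i hi => (totS_erase C hs hd hi).symm
  rw [Finset.sum_add_distrib, ← Finset.mul_sum, Finset.sum_const, smul_eq_mul] at h1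
  exact h1

theorem counting (C : ι → ι → ℕ) (hs : ∀ i j, C i j = C j i) (hd : ∀ i, C i i = 0)
    (htri : ∀ i j k, i ≠ j → j ≠ k → i ≠ k →
      4 ≤ C i j + C j k + C i k ∧ (C i j + C j k + C i k) % 2 = 0)
    (hn : NoConf C) :
    ∀ (N : ℕ) (S : Finset ι), S.card = N → 2 * (4 * (N / 2) * ((N - 1) / 2)) ≤ totS C S := by
  intro N
  induction N using Nat.strong_induction_on with
  | _ N ih =>
  intro S hS
  rcases Nat.lt_or_ge N 3 with h3 | h3
  · interval_cases N <;> simp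
  have hse := sum_tot_erase C hs hd S
  rw [hS] at hse
  rcases Nat.even_or_odd N with he | ho
  · obtain ⟨k, rfl⟩ : ∃ k, N = 2 * k + 4 := by
      obtain ⟨m, rfl⟩ := he
      exact ⟨m - 2, by omega⟩
    have h1 : ∑ i ∈ S, 2 * (4 * ((2 * k + 3) / 2) * ((2 * k + 3 - 1) / 2)) ≤
        ∑ i ∈ S, totS C (S.erase i) :=
      Finset.sum_le_sum fun i hi => ih (2 * k + 3) (by omega) _ (by
        rw [Finset.card_erase_of_mem hi, hS]; omega)
    rw [Finset.sum_const, hS, smul_eq_mul] at h1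
    have e1 : (2 * k + 3) / 2 = k + 1 := by omega
    have e2 : (2 * k + 3 - 1) / 2 = k + 1 := by omega
    have e3 : (2 * k + 4) / 2 = k + 2 := by omega
    have e4 : (2 * k + 4 - 1) / 2 = k + 1 := by omega
    rw [e1, e2] at h1
    rw [e3, e4]
    by_contra hlt
    push Not at hlt
    nlinarith
  · obtain ⟨k, rfl⟩ : ∃ k, N = 2 * k + 1 := ho
    have e1 : (2 * k + 1) / 2 = k := by omega
    have e2 : (2 * k + 1 - 1) / 2 = k := by omega
    rw [e1, e2]
    rcases Nat.lt_or_ge k 2 with hk1 | hk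
    · obtain rfl : k = 1 := by omega
      obtain ⟨x, y, z, hxy, hxz, hyz, rfl⟩ := Finset.card_eq_three.mp hS
      have := (htri x y z hxy hyz hxz).1
      have h2 := totS_insert C hs hd (S := {y, z}) (a := x) (by simp [hxy, hxz])
      have h4 := totS_insert C hs hd (S := {z}) (a := y) (by simp [hyz])
      have h5 : rowS C {y, z} x = C x y + C x z := by simp [rowS, Finset.sum_pair hyz]
      have h6 : rowS C {z} y = C y z := by simp [rowS]
      omega
    by_cases hz : ∃ u ∈ S, ∃ v ∈ S, u ≠ v ∧ C u v = 0
    · obtain ⟨u, hu, v, hv, huv, h0⟩ := hz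
      have hv' : v ∈ S.erase u := Finset.mem_erase.mpr ⟨huv.symm, hv⟩
      set T := (S.erase u).erase v with hT
      have hTc : T.card = 2 * k - 1 := by
        rw [hT, Finset.card_erase_of_mem hv', Finset.card_erase_of_mem hu, hS]; omega
      have hvT : v ∉ T := Finset.notMem_erase _ _
      have hiv : insert v T = S.erase u := Finset.insert_erase hv'
      have huT : u ∉ insert v T := by rw [hiv]; exact Finset.notMem_erase _ _
      have hST : S = insert u (insert v T) := by rw [hiv, Finset.insert_erase hu]
      have h1 := totS_insert C hs hd huT
      rw [totS_insert C hs hd hvT, rowS_insert C hvT, h0, ← hST] at h1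
      have h2 := ih (2 * k - 1) (by omega) T hTc
      have h4 : T.card * 4 ≤ rowS C T u + rowS C T v := by
        unfold rowS
        rw [← Finset.sum_add_distrib, ← smul_eq_mul, ← Finset.sum_const]
        refine Finset.sum_le_sum fun j hj => ?_
        have hju : u ≠ j := fun hh => huT (hh ▸ Finset.mem_insert_of_mem hj)
        have hjv : v ≠ j := fun hh => hvT (hh ▸ hj)
        have := (htri u v j huv hjv hju).1
        omega
      obtain ⟨m, rfl⟩ : ∃ m, k = m + 1 := ⟨k - 1, by omega⟩
      have e3 : (2 * (m + 1) - 1) / 2 = m := by omega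
      have e4 : (2 * (m + 1) - 1 - 1) / 2 = m := by omega
      rw [e3, e4] at h2
      rw [hTc] at h4
      have e5 : 2 * (m + 1) - 1 = 2 * m + 1 := by omega
      rw [e5] at h4
      nlinarith
    · push Not at hz
      by_contra hlt
      push Not at hlt
      have hne : S.Nonempty := Finset.card_pos.mp (by omega)
      obtain ⟨u₀, hu₀⟩ := hne
      have hpar : ∀ i j, (C i j + C u₀ i + C u₀ j) % 2 = 0 := by
        intro i j
        by_cases hij : i = j
        · subst hij; rw [hd]; omega
        by_cases hi : i = u₀
        · subst hi; rw [hd]; omega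
        by_cases hj : j = u₀
        · subst hj; rw [hd, hs i j]; omega
        have := (htri i j u₀ hij hj hi).2
        rw [hs j u₀, hs i u₀] at this
        omega
      set P := S.filter fun i => C u₀ i % 2 = 0 with hP
      set Q := S.filter fun i => ¬ C u₀ i % 2 = 0 with hQ
      have hPQ : Disjoint P Q := Finset.disjoint_filter_filter_not _ _ _
      have hU : P ∪ Q = S := Finset.filter_union_filter_not_eq _ _
      have hPm : ∀ i ∈ P, C u₀ i % 2 = 0 := fun i hi => (Finset.mem_filter.mp hi).2
      have hQm : ∀ i ∈ Q, C u₀ i % 2 = 1 := fun i hi => by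
        have := (Finset.mem_filter.mp hi).2; omega
      have hPP : ∀ i ∈ P, ∀ j ∈ P, C i j % 2 = 0 := fun i hi j hj => by
        have := hpar i j; have := hPm i hi; have := hPm j hj; omega
      have hQQ : ∀ i ∈ Q, ∀ j ∈ Q, C i j % 2 = 0 := fun i hi j hj => by
        have := hpar i j; have := hQm i hi; have := hQm j hj; omega
      have hPQo : ∀ i ∈ P, ∀ j ∈ Q, C i j % 2 = 1 := fun i hi j hj => by
        have := hpar i j; have := hPm i hi; have := hQm j hj; omega
      have hQPo : ∀ i ∈ Q, ∀ j ∈ P, C i j % 2 = 1 := fun i hi j hj => by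
        rw [hs]; exact hPQo j hj i hi
      have hcard : P.card + Q.card = 2 * k + 1 := by
        rw [← Finset.card_union_of_disjoint hPQ, hU, hS]
      have h4 : 4 ∣ totS C S := by
        rw [← hU, totS_union C hs hPQ]
        have a1 := totS_even4 C hs hd P fun i hi j hj => Nat.even_iff.mpr (hPP i hi j hj)
        have a2 := totS_even4 C hs hd Q fun i hi j hj => Nat.even_iff.mpr (hQQ i hi j hj)
        have a3 : (∑ i ∈ P, rowS C Q i) % 2 = 0 := by
          rcases Nat.even_or_odd Q.card with hq | hq
          · refine sum_even_mod _ _ fun i hi => ?_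
            have := sum_odd_mod (C i) Q (hPQo i hi)
            have := Nat.even_iff.mp hq
            unfold rowS; omega
          · have hp : P.card % 2 = 0 := by have := Nat.odd_iff.mp hq; omega
            rw [sum_odd_mod _ P fun i hi => ?_, hp]
            have := sum_odd_mod (C i) Q (hPQo i hi)
            have := Nat.odd_iff.mp hq
            unfold rowS; omega
        omega
      have her : ∀ i ∈ S, 2 * (4 * k * (k - 1)) ≤ totS C (S.erase i) := fun i hi => by
        have := ih (2 * k) (by omega) (S.erase i) (by rw [Finset.card_erase_of_mem hi, hS]; omega)
        have e3 : 2 * k / 2 = k := by omega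
        have e4 : (2 * k - 1) / 2 = k - 1 := by omega
        rwa [e3, e4] at this
      have hsum : ∑ i ∈ S, 2 * (4 * k * (k - 1)) ≤ ∑ i ∈ S, totS C (S.erase i) :=
        Finset.sum_le_sum her
      rw [Finset.sum_const, hS, smul_eq_mul] at hsum
      obtain ⟨m, rfl⟩ : ∃ m, k = m + 2 := ⟨k - 2, by omega⟩
      have e5 : m + 2 - 1 = m + 1 := by omega
      rw [e5] at hsum her
      have hT : totS C S + 4 = 8 * (m + 2) ^ 2 := by
        obtain ⟨t, ht⟩ := h4
        rw [ht] at hse hlt ⊢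
        have q1 : t < 2 * (m + 2) ^ 2 := by nlinarith
        have q2 : 2 * (m + 2) ^ 2 ≤ t + 1 := by
          by_contra hh
          push Not at hh
          have hh' := Nat.mul_le_mul_left (2 * m + 3) (Nat.succ_le_of_lt hh)
          nlinarith
        nlinarith
      have hrow : ∀ i ∈ S, rowS C S i ≤ 4 * (m + 2) - 2 := fun i hi => by
        have a := her i hi
        have b := totS_erase C hs hd hi
        have : 8 * (m + 2) ^ 2 = 2 * (4 * (m + 2) * (m + 1)) + 8 * (m + 2) := by ring
        omega
      rcases Nat.even_or_odd P.card with hp | hp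
      · exact crit C hs hd hn P Q hPQ (m + 2) hk (by rw [hU, hS]) hp
          (by rw [hU]; exact hz) hPP hQQ hPQo (by rw [hU, hT]) (by rw [hU]; exact hrow)
      · have hU' : Q ∪ P = S := by rw [Finset.union_comm, hU]
        exact crit C hs hd hn Q P hPQ.symm (m + 2) hk (by rw [hU', hS])
          (Nat.even_iff.mpr (by have := Nat.odd_iff.mp hp; omega))
          (by rw [hU']; exact hz) hQQ hPP hQPo (by rw [hU', hT]) (by rw [hU']; exact hrow)

end Counting
end K5n


namespace K5n

/-- First endpoint of the `k`-th pair. -/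
def fs : Fin 10 → Fin 5 := ![0, 0, 0, 0, 1, 1, 1, 2, 2, 3]
/-- Second endpoint of the `k`-th pair. -/
def sn : Fin 10 → Fin 5 := ![1, 2, 3, 4, 2, 3, 4, 3, 4, 4]

/-- Weight of a boolean vector. -/
def wt (f : Fin 10 → Bool) : ℕ := ∑ k, (f k).toNat

lemma wt_eq (f : Fin 10 → Bool) : wt f = (f 0).toNat + ((f 1).toNat + ((f 2).toNat +
    ((f 3).toNat + ((f 4).toNat + ((f 5).toNat + ((f 6).toNat + ((f 7).toNat +
    ((f 8).toNat + (f 9).toNat)))))))) := by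
  simp only [wt, Fin.sum_univ_succ, Fin.sum_univ_zero]
  rfl

/-- Pair `k` joins `x` and `y`. -/
def PE (k : Fin 10) (x y : Fin 5) : Prop := (fs k = x ∧ sn k = y) ∨ (fs k = y ∧ sn k = x)

instance (k : Fin 10) (x y : Fin 5) : Decidable (PE k x y) := by unfold PE; infer_instance

lemma dec_tri : ∀ r0 r1 r2 r3 r4 : Bool,
    4 ≤ wt (fun k => !(![r0, r1, r2, r3, r4] (fs k) ^^ ![r0, r1, r2, r3, r4] (sn k))) ∧
    wt (fun k => !(![r0, r1, r2, r3, r4] (fs k) ^^ ![r0, r1, r2, r3, r4] (sn k))) % 2 = 0 := by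
  simp only [wt_eq, fs, sn, Matrix.cons_val, Matrix.cons_val_zero, Matrix.cons_val_one]
  decide +kernel

lemma dec_D1 : ∀ (r0 r1 r2 r3 r4 : Bool) (e f : Fin 10),
    wt (fun k => (!(![r0, r1, r2, r3, r4] (fs k) ^^ ![r0, r1, r2, r3, r4] (sn k))) ^^
      (decide (k = e) ^^ decide (k = f))) = 2 →
    e ≠ f ∧ ![r0, r1, r2, r3, r4] (fs e) = ![r0, r1, r2, r3, r4] (sn e) ∧
      ![r0, r1, r2, r3, r4] (fs f) = ![r0, r1, r2, r3, r4] (sn f) ∧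
      (r0.toNat + r1.toNat + r2.toNat + r3.toNat + r4.toNat = 2 ∨
       r0.toNat + r1.toNat + r2.toNat + r3.toNat + r4.toNat = 3) := by
  simp only [wt_eq, fs, sn, Matrix.cons_val, Matrix.cons_val_zero, Matrix.cons_val_one]
  decide +kernel

lemma dec_four : ∀ (r0 r1 r2 r3 r4 : Bool) (x y z t : Fin 5), 
    (r0.toNat + r1.toNat + r2.toNat + r3.toNat + r4.toNat = 2 ∨
       r0.toNat + r1.toNat + r2.toNat + r3.toNat + r4.toNat = 3) →
    x ≠ y → x ≠ z → x ≠ t → y ≠ z → y ≠ t → z ≠ t →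
    ![r0, r1, r2, r3, r4] x = ![r0, r1, r2, r3, r4] y →
    ![r0, r1, r2, r3, r4] y = ![r0, r1, r2, r3, r4] z →
    ![r0, r1, r2, r3, r4] z = ![r0, r1, r2, r3, r4] t → False := by
  have key : ∀ x y : Fin 5, x ≠ y → ∀ z, x ≠ z → y ≠ z → ∀ t, x ≠ t → y ≠ t → z ≠ t →
      ∀ r0 r1 r2 r3 r4 : Bool,
      ![r0, r1, r2, r3, r4] x = ![r0, r1, r2, r3, r4] y →
      ![r0, r1, r2, r3, r4] y = ![r0, r1, r2, r3, r4] z →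
      ![r0, r1, r2, r3, r4] z = ![r0, r1, r2, r3, r4] t →
      ¬ (r0.toNat + r1.toNat + r2.toNat + r3.toNat + r4.toNat = 2 ∨
       r0.toNat + r1.toNat + r2.toNat + r3.toNat + r4.toNat = 3) := by
    decide +kernel
  intro r0 r1 r2 r3 r4 x y z t h h1 h2 h3 h4 h5 h6 h7 h8 h9
  exact key x y h1 z h2 h4 t h3 h5 h6 r0 r1 r2 r3 r4 h7 h8 h9 h

lemma vec5 (r : Fin 5 → Bool) : ![r 0, r 1, r 2, r 3, r 4] = r := by
  funext i; fin_cases i <;> rfl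

/-- Value of the sum of four edges. -/
def val (e f g h k : Fin 10) : Bool :=
  (decide (k = e) ^^ decide (k = f)) ^^ (decide (k = g) ^^ decide (k = h))

/-- The sum of four edges is a cut. -/
def isCut (e f g h : Fin 10) : Prop :=
  val e f g h 4 = (val e f g h 0 ^^ val e f g h 1) ∧
  val e f g h 5 = (val e f g h 0 ^^ val e f g h 2) ∧
  val e f g h 6 = (val e f g h 0 ^^ val e f g h 3) ∧
  val e f g h 7 = (val e f g h 1 ^^ val e f g h 2) ∧
  val e f g h 8 = (val e f g h 1 ^^ val e f g h 3) ∧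
  val e f g h 9 = (val e f g h 2 ^^ val e f g h 3)

instance (e f g h : Fin 10) : Decidable (isCut e f g h) := by unfold isCut; infer_instance

/-- Incidence. -/
def inc (k : Fin 10) (y : Fin 5) : Prop := fs k = y ∨ sn k = y

instance (k : Fin 10) (y : Fin 5) : Decidable (inc k y) := by unfold inc; infer_instance

lemma dec_D3 : ∀ e f g h : Fin 10, e ≠ f → isCut e f g h →
    (∀ y, inc e y → inc f y → inc g y) ∧
    ((∀ y, inc e y → ¬ inc f y) → g = e ∨ g = f) := by
  decide +kernel

/-- The degree in a set of pairs. -/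
def deg (m : Fin 10 → Bool) (v : Fin 5) : ℕ :=
  ∑ k, (m k && decide (inc k v)).toNat

lemma deg_0 (m : Fin 10 → Bool) : deg m 0 = (m 0).toNat + (m 1).toNat + (m 2).toNat + (m 3).toNat := by
  simp [deg, Fin.sum_univ_succ, inc, fs, sn]
  omega

lemma deg_1 (m : Fin 10 → Bool) : deg m 1 = (m 0).toNat + (m 4).toNat + (m 5).toNat + (m 6).toNat := by
  simp [deg, Fin.sum_univ_succ, inc, fs, sn]
  omega

lemma deg_2 (m : Fin 10 → Bool) : deg m 2 = (m 1).toNat + (m 4).toNat + (m 7).toNat + (m 8).toNat := by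
  simp [deg, Fin.sum_univ_succ, inc, fs, sn]
  omega

lemma deg_3 (m : Fin 10 → Bool) : deg m 3 = (m 2).toNat + (m 5).toNat + (m 7).toNat + (m 9).toNat := by
  simp [deg, Fin.sum_univ_succ, inc, fs, sn]
  omega

lemma deg_4 (m : Fin 10 → Bool) : deg m 4 = (m 3).toNat + (m 6).toNat + (m 8).toNat + (m 9).toNat := by
  simp [deg, Fin.sum_univ_succ, inc, fs, sn]
  omega

/-- Some pair of the set joins x and y. -/
def hasE (m : Fin 10 → Bool) (x y : Fin 5) : Prop := ∃ k, m k = true ∧ PE k x y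

instance (m : Fin 10 → Bool) (x y : Fin 5) : Decidable (hasE m x y) := by
  unfold hasE; infer_instance

lemma dec_cyc : ∀ m0 m1 m2 m3 m4 m5 m6 m7 m8 m9 : Bool,
    (∀ v, deg ![m0, m1, m2, m3, m4, m5, m6, m7, m8, m9] v ≤ 2) →
    wt ![m0, m1, m2, m3, m4, m5, m6, m7, m8, m9] = 5 →
    ∃ p1, hasE ![m0, m1, m2, m3, m4, m5, m6, m7, m8, m9] 0 p1 ∧
    ∃ p2, hasE ![m0, m1, m2, m3, m4, m5, m6, m7, m8, m9] p1 p2 ∧ p2 ≠ 0 ∧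
    ∃ p3, hasE ![m0, m1, m2, m3, m4, m5, m6, m7, m8, m9] p2 p3 ∧ p3 ≠ p1 ∧ p3 ≠ 0 ∧
    ∃ p4, hasE ![m0, m1, m2, m3, m4, m5, m6, m7, m8, m9] p3 p4 ∧ p4 ≠ p2 ∧ p4 ≠ p1 ∧ p4 ≠ 0 ∧
      hasE ![m0, m1, m2, m3, m4, m5, m6, m7, m8, m9] p4 0 := by
  intro m0 m1 m2 m3 m4 m5 m6 m7 m8 m9 hd
  have d0 := hd 0
  have d1 := hd 1
  have d2 := hd 2
  have d3 := hd 3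
  have d4 := hd 4
  simp only [deg_0, deg_1, deg_2, deg_3, deg_4, wt_eq, Matrix.cons_val, Matrix.cons_val_zero,
    Matrix.cons_val_one] at d0 d1 d2 d3 d4 ⊢
  clear hd
  revert m0 m1 m2 m3 m4 m5 m6 m7 m8 m9
  decide +kernel

lemma dec_le5 : ∀ m0 m1 m2 m3 m4 m5 m6 m7 m8 m9 : Bool,
    (∀ v, deg ![m0, m1, m2, m3, m4, m5, m6, m7, m8, m9] v ≤ 2) →
    wt ![m0, m1, m2, m3, m4, m5, m6, m7, m8, m9] ≤ 5 := by
  intro m0 m1 m2 m3 m4 m5 m6 m7 m8 m9 hd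
  have d0 := hd 0
  have d1 := hd 1
  have d2 := hd 2
  have d3 := hd 3
  have d4 := hd 4
  simp only [deg_0, deg_1, deg_2, deg_3, deg_4, wt_eq, Matrix.cons_val, Matrix.cons_val_zero,
    Matrix.cons_val_one] at d0 d1 d2 d3 d4 ⊢
  omega

lemma vec10 (m : Fin 10 → Bool) :
    ![m 0, m 1, m 2, m 3, m 4, m 5, m 6, m 7, m 8, m 9] = m := by
  funext i; fin_cases i <;> rfl

end K5n


namespace K5n

set_option linter.unusedSectionVars false

lemma D1 (r : Fin 5 → Bool) (e f : Fin 10)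
    (h : wt (fun k => (!(r (fs k) ^^ r (sn k))) ^^ (decide (k = e) ^^ decide (k = f))) = 2) :
    e ≠ f ∧ r (fs e) = r (sn e) ∧ r (fs f) = r (sn f) ∧
      ∀ x y z t : Fin 5, x ≠ y → x ≠ z → x ≠ t → y ≠ z → y ≠ t → z ≠ t →
        r x = r y → r y = r z → r z = r t → False := by
  have h1 := dec_D1 (r 0) (r 1) (r 2) (r 3) (r 4) e f
  have h2 := dec_four (r 0) (r 1) (r 2) (r 3) (r 4)
  rw [vec5 r] at h1 h2
  obtain ⟨a, b, c, d⟩ := h1 h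
  exact ⟨a, b, c, fun x y z t => h2 x y z t d⟩

lemma PE_unique {k : Fin 10} {x y z t : Fin 5} (h : PE k x y) (h' : PE k z t) :
    (x = z ∧ y = t) ∨ (x = t ∧ y = z) := by
  unfold PE at h h'
  rcases h with ⟨rfl, rfl⟩ | ⟨rfl, rfl⟩ <;> rcases h' with ⟨rfl, rfl⟩ | ⟨rfl, rfl⟩ <;> simp

lemma PE_inj : ∀ {k k' : Fin 10} {x y : Fin 5}, PE k x y → PE k' x y → k = k' := by
  decide +kernel

lemma PE_ne : ∀ {k : Fin 10} {x y : Fin 5}, PE k x y → x ≠ y := by decide +kernel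

lemma PE_of_inc {k : Fin 10} {x : Fin 5} (h : inc k x) : ∃ y, PE k x y := by
  rcases h with rfl | rfl
  · exact ⟨_, Or.inl ⟨rfl, rfl⟩⟩
  · exact ⟨_, Or.inr ⟨rfl, rfl⟩⟩

lemma PE_eq {r : Fin 5 → Bool} {k : Fin 10} {x y : Fin 5} (h : PE k x y)
    (h' : r (fs k) = r (sn k)) : r x = r y := by
  rcases h with ⟨rfl, rfl⟩ | ⟨rfl, rfl⟩
  · exact h'
  · exact h'.symm

lemma odd5 : ∀ A B C D E : Bool, A ≠ B → B ≠ C → C ≠ D → D ≠ E → E ≠ A → False := by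
  intro A B C D E
  cases A <;> cases B <;> cases C <;> cases D <;> cases E <;> simp

/-- Configuration of edges and local orders. -/
structure Conf {ι : Type*} (Q : Finset ι) (e : ι → Fin 10) (T : ι → ι → Fin 5 → Bool) : Prop where
  d1 : ∀ w ∈ Q, ∀ w' ∈ Q, w ≠ w' → e w ≠ e w' ∧ T w w' (fs (e w)) = T w w' (sn (e w)) ∧
    T w w' (fs (e w')) = T w w' (sn (e w')) ∧
    ∀ x y z t : Fin 5, x ≠ y → x ≠ z → x ≠ t → y ≠ z → y ≠ t → z ≠ t →
        T w w' x = T w w' y → T w w' y = T w w' z → T w w' z = T w w' t → False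
  tr : ∀ w ∈ Q, ∀ w' ∈ Q, ∀ w'' ∈ Q, w ≠ w' → w' ≠ w'' → w ≠ w'' → ∀ a,
    T w w' a = T w' w'' a → T w w'' a = T w w' a

section
variable {ι : Type*} {Q : Finset ι} {e : ι → Fin 10} {T : ι → ι → Fin 5 → Bool}

lemma Conf.noStar (h : Conf Q e T) {w₁ w₂ w₃ : ι} (h₁ : w₁ ∈ Q) (h₂ : w₂ ∈ Q) (h₃ : w₃ ∈ Q)
    (h12 : w₁ ≠ w₂) (h23 : w₂ ≠ w₃) (h13 : w₁ ≠ w₃) (v : Fin 5)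
    (i₁ : inc (e w₁) v) (i₂ : inc (e w₂) v) (i₃ : inc (e w₃) v) : False := by
  obtain ⟨a, ha⟩ := PE_of_inc i₁
  obtain ⟨b, hb⟩ := PE_of_inc i₂
  obtain ⟨c, hc⟩ := PE_of_inc i₃
  obtain ⟨n12, p12, q12, f12⟩ := h.d1 _ h₁ _ h₂ h12
  obtain ⟨n23, p23, q23, f23⟩ := h.d1 _ h₂ _ h₃ h23
  obtain ⟨n13, p13, q13, f13⟩ := h.d1 _ h₁ _ h₃ h13
  have hab : a ≠ b := fun hh => n12 (PE_inj ha (hh ▸ hb))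
  have hbc : b ≠ c := fun hh => n23 (PE_inj hb (hh ▸ hc))
  have hac : a ≠ c := fun hh => n13 (PE_inj ha (hh ▸ hc))
  have hva := PE_ne ha
  have hvb := PE_ne hb
  have hvc := PE_ne hc
  have x1 := PE_eq ha p12
  have x2 := PE_eq hb q12
  have y1 := PE_eq hb p23
  have y2 := PE_eq hc q23
  have z1 := PE_eq ha p13
  have z2 := PE_eq hc q13
  have f1 := f12 a v b c hva.symm hab hac hvb hvc hbc
  have f2 := f23 b v c a hvb.symm hbc hab.symm hvc hva hac.symm
  have f3 := f13 a v c b hva.symm hac hab hvc hvb hbc.symm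
  have t := h.tr _ h₁ _ h₂ _ h₃ h12 h23 h13
  have tv := t v
  have ta := t a
  have tb := t b
  have tc := t c
  revert x1 x2 y1 y2 z1 z2 f1 f2 f3 tv ta tb tc
  generalize T w₁ w₂ v = A1
  generalize T w₁ w₂ a = A2
  generalize T w₁ w₂ b = A3
  generalize T w₁ w₂ c = A4
  generalize T w₂ w₃ v = B1
  generalize T w₂ w₃ a = B2
  generalize T w₂ w₃ b = B3
  generalize T w₂ w₃ c = B4
  generalize T w₁ w₃ v = C1
  generalize T w₁ w₃ a = C2
  generalize T w₁ w₃ b = C3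
  generalize T w₁ w₃ c = C4
  clear * -
  intro x1 x2 y1 y2 z1 z2 f1 f2 f3 tv ta tb tc
  subst x1 x2 y1 y2 z1 z2
  have two : ∀ a b c : Bool, a ≠ b → c ≠ b → a = c := by decide
  have g1 := f1 rfl rfl
  have g2 := f2 rfl rfl
  have g3 := f3 rfl rfl
  by_cases h : A1 = B1
  · exact g3 ((tv h).trans (tb h).symm)
  · have k1 := ta (two _ _ _ h (Ne.symm g2))
    have k2 := tc (two _ _ _ (Ne.symm g1) (Ne.symm h))
    exact g1 (k1.symm.trans k2)

lemma Conf.path (h : Conf Q e T) {w₁ w₂ w₃ : ι} (h₁ : w₁ ∈ Q) (h₂ : w₂ ∈ Q) (h₃ : w₃ ∈ Q)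
    {x y z t : Fin 5} (e₁ : PE (e w₁) x y) (e₂ : PE (e w₂) y z) (e₃ : PE (e w₃) z t)
    (hxz : x ≠ z) (hxt : x ≠ t) (hyt : y ≠ t) : T w₁ w₂ y ≠ T w₂ w₃ z := by
  have hxy := PE_ne e₁
  have hyz := PE_ne e₂
  have hzt := PE_ne e₃
  have h12 : w₁ ≠ w₂ := by
    rintro rfl; rcases PE_unique e₁ e₂ with hh | hh
    · exact hxy hh.1
    · exact hxz hh.1
  have h23 : w₂ ≠ w₃ := by
    rintro rfl; rcases PE_unique e₂ e₃ with hh | hh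
    · exact hyz hh.1
    · exact hyt hh.1
  have h13 : w₁ ≠ w₃ := by
    rintro rfl; rcases PE_unique e₁ e₃ with hh | hh
    · exact hxz hh.1
    · exact hxt hh.1
  obtain ⟨n12, p12, q12, f12⟩ := h.d1 _ h₁ _ h₂ h12
  obtain ⟨n23, p23, q23, f23⟩ := h.d1 _ h₂ _ h₃ h23
  obtain ⟨n13, p13, q13, f13⟩ := h.d1 _ h₁ _ h₃ h13
  have x2 := PE_eq e₂ q12
  have y1 := PE_eq e₂ p23
  have z1 := PE_eq e₁ p13
  have z2 := PE_eq e₃ q13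
  have f3 := f13 x y z t hxy hxz hxt hyz hyt hzt z1
  have tr := h.tr _ h₁ _ h₂ _ h₃ h12 h23 h13
  have ty := tr y
  have tz := tr z
  intro hcon
  rw [← hcon] at y1 tz
  rw [y1] at ty
  rw [← x2] at tz
  exact f3 ((ty rfl).trans (tz rfl).symm) z2

open Classical in
lemma Conf.deg_le (h : Conf Q e T) (v : Fin 5) : deg (fun k => decide (k ∈ Q.image e)) v ≤ 2 := by
  have hc : deg (fun k => decide (k ∈ Q.image e)) v =
      (Finset.univ.filter fun k => k ∈ Q.image e ∧ inc k v).card := by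
    unfold deg
    rw [Finset.card_filter]
    refine Finset.sum_congr rfl fun k _ => ?_
    by_cases h1 : k ∈ Q.image e <;> by_cases h2 : inc k v <;> simp [h1, h2]
  rw [hc]
  by_contra hlt
  push Not at hlt
  obtain ⟨a, b, c, ha, hb, hc, hab, hac, hbc⟩ := Finset.two_lt_card_iff.mp hlt
  simp only [Finset.mem_filter, Finset.mem_univ, true_and, Finset.mem_image] at ha hb hc
  obtain ⟨⟨w₁, m1, rfl⟩, i1⟩ := ha
  obtain ⟨⟨w₂, m2, rfl⟩, i2⟩ := hb
  obtain ⟨⟨w₃, m3, rfl⟩, i3⟩ := hc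
  exact h.noStar m1 m2 m3 (fun hh => hab (by rw [hh])) (fun hh => hbc (by rw [hh]))
    (fun hh => hac (by rw [hh])) v i1 i2 i3

open Classical in
lemma Conf.wt_eq (h : Conf Q e T) : wt (fun k => decide (k ∈ Q.image e)) = Q.card := by
  have : (Q.image e).card = Q.card := Finset.card_image_of_injOn fun w hw w' hw' hh => by
    by_contra hne
    exact (h.d1 w hw w' hw' hne).1 hh
  rw [← this, wt]
  have h2 : Q.image e = Finset.univ.filter fun k => k ∈ Q.image e := by ext; simp
  conv_rhs => rw [h2, Finset.card_filter]
  refine Finset.sum_congr rfl fun k _ => ?_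
  by_cases h1 : k ∈ Q.image e <;> simp [h1]

lemma Conf.card_le (h : Conf Q e T) : Q.card ≤ 5 := by
  classical
  rw [← h.wt_eq]
  have := dec_le5 (decide (0 ∈ Q.image e)) (decide (1 ∈ Q.image e)) (decide (2 ∈ Q.image e))
    (decide (3 ∈ Q.image e)) (decide (4 ∈ Q.image e)) (decide (5 ∈ Q.image e))
    (decide (6 ∈ Q.image e)) (decide (7 ∈ Q.image e)) (decide (8 ∈ Q.image e))
    (decide (9 ∈ Q.image e))
  rw [vec10 (fun k => decide (k ∈ Q.image e))] at this
  exact this h.deg_le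

lemma Conf.card_ne (h : Conf Q e T) : Q.card ≠ 5 := by
  classical
  intro h5
  rw [← h.wt_eq] at h5
  have := dec_cyc (decide (0 ∈ Q.image e)) (decide (1 ∈ Q.image e)) (decide (2 ∈ Q.image e))
    (decide (3 ∈ Q.image e)) (decide (4 ∈ Q.image e)) (decide (5 ∈ Q.image e))
    (decide (6 ∈ Q.image e)) (decide (7 ∈ Q.image e)) (decide (8 ∈ Q.image e))
    (decide (9 ∈ Q.image e))
  rw [vec10 (fun k => decide (k ∈ Q.image e))] at this
  obtain ⟨p1, e0, p2, e1, n20, p3, e2, n31, n30, p4, e3, n42, n41, n40, e4⟩ := this h.deg_le h5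
  have key : ∀ x y, hasE (fun k => decide (k ∈ Q.image e)) x y → ∃ w ∈ Q, PE (e w) x y := by
    rintro x y ⟨k, hk, hp⟩
    obtain ⟨w, hw, rfl⟩ := Finset.mem_image.mp (of_decide_eq_true hk)
    exact ⟨w, hw, hp⟩
  obtain ⟨w0, q0, e0⟩ := key _ _ e0
  obtain ⟨w1, q1, e1⟩ := key _ _ e1
  obtain ⟨w2, q2, e2⟩ := key _ _ e2
  obtain ⟨w3, q3, e3⟩ := key _ _ e3
  obtain ⟨w4, q4, e4⟩ := key _ _ e4
  have a0 := h.path q0 q1 q2 e0 e1 e2 n20.symm n30.symm n31.symm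
  have a1 := h.path q1 q2 q3 e1 e2 e3 n31.symm n41.symm n42.symm
  have a2 := h.path q2 q3 q4 e2 e3 e4 n42.symm n20 n30
  have a3 := h.path q3 q4 q0 e3 e4 e0 n30 n31 n41
  have a4 := h.path q4 q0 q1 e4 e0 e1 n41 n42 n20.symm
  exact odd5 _ _ _ _ _ a0 a1 a2 a3 a4

end

/-- The combinatorial data extracted from a drawing. -/
structure Dat (ι : Type*) where
  lt : Fin 5 → ι → ι → Bool
  mb : Fin 10 → ι → Bool
  anti : ∀ a i j, i ≠ j → lt a j i = !lt a i j
  trans : ∀ a i j l, i ≠ j → j ≠ l → i ≠ l → lt a i j = true → lt a j l = true → lt a i l = true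

namespace Dat
variable {ι : Type*} [DecidableEq ι] (D : Dat ι)

/-- The parity bit. -/
def x (k : Fin 10) (i j : ι) : Bool :=
  (!(D.lt (fs k) i j ^^ D.lt (sn k) i j)) ^^ (D.mb k i ^^ D.mb k j)

/-- Number of odd pairs. -/
def C (i j : ι) : ℕ := if i = j then 0 else wt (fun k => D.x k i j)

/-- The triple sign. -/
def T (u w w' : ι) (a : Fin 5) : Bool := D.lt a u w ^^ (D.lt a w w' ^^ D.lt a u w')

lemma C_ne {i j : ι} (h : i ≠ j) : D.C i j = wt (fun k => D.x k i j) := if_neg h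

lemma x_symm {i j : ι} (h : i ≠ j) (k : Fin 10) : D.x k i j = D.x k j i := by
  unfold x
  rw [D.anti (fs k) i j h, D.anti (sn k) i j h]
  generalize D.lt (fs k) i j = a
  generalize D.lt (sn k) i j = b
  generalize D.mb k i = c
  generalize D.mb k j = d
  revert a b c d; decide

lemma C_symm (i j : ι) : D.C i j = D.C j i := by
  by_cases h : i = j
  · rw [h]
  · rw [D.C_ne h, D.C_ne (Ne.symm h)]
    congr 1; funext k; exact D.x_symm h k

lemma C_self (i : ι) : D.C i i = 0 := if_pos rfl

lemma x_tri (k : Fin 10) (u w w' : ι) :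
    D.x k w w' = ((!(D.T u w w' (fs k) ^^ D.T u w w' (sn k))) ^^ (D.x k u w ^^ D.x k u w')) := by
  unfold x T
  generalize D.lt (fs k) u w = a1
  generalize D.lt (sn k) u w = a2
  generalize D.lt (fs k) w w' = a3
  generalize D.lt (sn k) w w' = a4
  generalize D.lt (fs k) u w' = a5
  generalize D.lt (sn k) u w' = a6
  generalize D.mb k u = a7
  generalize D.mb k w = a8
  generalize D.mb k w' = a9
  revert a1 a2 a3 a4 a5 a6 a7 a8 a9; decide +kernel

lemma tri (i j k : ι) (hij : i ≠ j) (hjk : j ≠ k) (hik : i ≠ k) :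
    4 ≤ D.C i j + D.C j k + D.C i k ∧ (D.C i j + D.C j k + D.C i k) % 2 = 0 := by
  rw [D.C_ne hij, D.C_ne hjk, D.C_ne hik]
  have h := dec_tri (D.T i j k 0) (D.T i j k 1) (D.T i j k 2) (D.T i j k 3) (D.T i j k 4)
  rw [vec5 (D.T i j k)] at h
  have hb : ∀ a b c : Bool, (a ^^ (b ^^ c)).toNat ≤ b.toNat + a.toNat + c.toNat ∧
      (b.toNat + a.toNat + c.toNat) % 2 = (a ^^ (b ^^ c)).toNat % 2 := by decide
  have he : ∀ l, (!(D.T i j k (fs l) ^^ D.T i j k (sn l))) =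
      (D.x l j k ^^ (D.x l i j ^^ D.x l i k)) := by
    intro l
    rw [D.x_tri l i j k]
    generalize (!(D.T i j k (fs l) ^^ D.T i j k (sn l))) = a
    generalize D.x l i j = b
    generalize D.x l i k = c
    revert a b c; decide
  simp only [he] at h
  have h1 : wt (fun l => D.x l j k ^^ (D.x l i j ^^ D.x l i k)) ≤
      wt (fun l => D.x l i j) + wt (fun l => D.x l j k) + wt (fun l => D.x l i k) := by
    unfold wt
    rw [← Finset.sum_add_distrib, ← Finset.sum_add_distrib]
    exact Finset.sum_le_sum fun l _ => (hb _ _ _).1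
  have h2 : (wt (fun l => D.x l i j) + wt (fun l => D.x l j k) + wt (fun l => D.x l i k)) % 2 =
      wt (fun l => D.x l j k ^^ (D.x l i j ^^ D.x l i k)) % 2 := by
    unfold wt
    rw [← Finset.sum_add_distrib, ← Finset.sum_add_distrib]
    refine Finset.sum_nat_mod .. |>.trans ?_
    rw [Finset.sum_congr rfl fun l _ => (hb _ _ _).2, ← Finset.sum_nat_mod]
  omega

lemma wt_one {f : Fin 10 → Bool} (h : wt f = 1) : ∃ e, ∀ k, f k = decide (k = e) := by
  unfold wt at h
  have hne : ∃ e, f e = true := by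
    by_contra hh
    push Not at hh
    simp [Finset.sum_eq_zero, hh] at h
  obtain ⟨e, he⟩ := hne
  refine ⟨e, fun k => ?_⟩
  by_cases hk : k = e
  · subst hk; simp [he]
  · rw [← Finset.add_sum_erase _ _ (Finset.mem_univ e), he] at h
    have h0 : ∑ k ∈ Finset.univ.erase e, (f k).toNat = 0 := by
      simpa using h
    have := Finset.sum_eq_zero_iff.mp h0 k (Finset.mem_erase.mpr ⟨hk, Finset.mem_univ _⟩)
    simp only [hk, decide_false]
    simpa using this

lemma conf (u : ι) (Q : Finset ι) (hu : u ∉ Q) (e : ι → Fin 10)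
    (he : ∀ w ∈ Q, ∀ k, D.x k u w = decide (k = e w))
    (h2 : ∀ w ∈ Q, ∀ w' ∈ Q, w ≠ w' → D.C w w' = 2) : Conf Q e (D.T u) where
  d1 w hw w' hw' hne := by
    apply D1
    rw [← h2 w hw w' hw' hne, D.C_ne hne]
    congr 1; funext k
    rw [D.x_tri k u w w', he w hw, he w' hw']
  tr w hw w' hw' w'' hw'' h12 h23 h13 a := by
    have n1 : u ≠ w := fun h => hu (h ▸ hw)
    have n2 : u ≠ w' := fun h => hu (h ▸ hw')
    have n3 : u ≠ w'' := fun h => hu (h ▸ hw'')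
    have t : ∀ i j l, i ≠ j → j ≠ l → i ≠ l → D.lt a i j = true → D.lt a j l = true →
      D.lt a i l = true := D.trans a
    have an := D.anti a
    unfold T
    have t1 := t u w w' n1 h12 n2
    have t2 := t w w' u h12 n2.symm n1.symm
    have t3 := t w' u w n2.symm n1 h12.symm
    have t4 := t u w' w n2 h12.symm n1
    have t5 := t w' w u h12.symm n1.symm n2.symm
    have t6 := t w u w' n1.symm n2 h12
    have s1 := t u w' w'' n2 h23 n3
    have s2 := t w' w'' u h23 n3.symm n2.symm
    have s3 := t w'' u w' n3.symm n2 h23.symm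
    have s4 := t u w'' w' n3 h23.symm n2
    have s5 := t w'' w' u h23.symm n2.symm n3.symm
    have s6 := t w' u w'' n2.symm n3 h23
    have r1 := t u w w'' n1 h13 n3
    have r2 := t w w'' u h13 n3.symm n1.symm
    have r3 := t w'' u w n3.symm n1 h13.symm
    have r4 := t u w'' w n3 h13.symm n1
    have r5 := t w'' w u h13.symm n1.symm n3.symm
    have r6 := t w u w'' n1.symm n3 h13
    have q1 := t w w' w'' h12 h23 h13
    have q2 := t w' w'' w h23 h13.symm h12.symm
    have q3 := t w'' w w' h13.symm h12 h23.symm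
    have q4 := t w w'' w' h13 h23.symm h12
    have q5 := t w'' w' w h23.symm h12.symm h13.symm
    have q6 := t w' w w'' h12.symm h13 h23
    rw [an u w n1, an u w' n2, an u w'' n3, an w w' h12, an w w'' h13, an w' w'' h23] at *
    revert t1 t2 t3 t4 t5 t6 s1 s2 s3 s4 s5 s6 r1 r2 r3 r4 r5 r6 q1 q2 q3 q4 q5 q6
    generalize D.lt a u w = A1
    generalize D.lt a u w' = A2
    generalize D.lt a u w'' = A3
    generalize D.lt a w w' = A4
    generalize D.lt a w w'' = A5
    generalize D.lt a w' w'' = A6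
    clear * -
    cases A1 <;> cases A2 <;> cases A3 <;> cases A4 <;> cases A5 <;> cases A6 <;> simp

theorem noConf : NoConf D.C := by
  intro u v Q huv hu hv h1 h2 h3 ho hc
  have n1 : ∀ w ∈ Q, u ≠ w := fun w hw h => hu (h ▸ hw)
  have n2 : ∀ w ∈ Q, v ≠ w := fun w hw h => hv (h ▸ hw)
  have he : ∀ w, ∃ e, w ∈ Q → ∀ k, D.x k u w = decide (k = e) := by
    intro w
    by_cases hw : w ∈ Q
    · have := (h1 w hw).1
      rw [D.C_ne (n1 w hw)] at this
      obtain ⟨e, he⟩ := wt_one this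
      exact ⟨e, fun _ => he⟩
    · exact ⟨0, fun h => absurd h hw⟩
  have hf : ∀ w, ∃ e, w ∈ Q → ∀ k, D.x k v w = decide (k = e) := by
    intro w
    by_cases hw : w ∈ Q
    · have := (h1 w hw).2
      rw [D.C_ne (n2 w hw)] at this
      obtain ⟨e, he⟩ := wt_one this
      exact ⟨e, fun _ => he⟩
    · exact ⟨0, fun h => absurd h hw⟩
  choose e he using he
  choose f hf using hf
  have cf := D.conf u Q hu e he h2
  have c5 := cf.card_le
  have c5' := cf.card_ne
  have hodd := Nat.odd_iff.mp ho
  have c3 : Q.card = 3 := by omega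
  have huv2 : D.C u v = 2 := by omega
  obtain ⟨w₁, w₂, w₃, h12, h13, h23, hQ⟩ := Finset.card_eq_three.mp c3
  have m1 : w₁ ∈ Q := by simp [hQ]
  have m2 : w₂ ∈ Q := by simp [hQ]
  have m3 : w₃ ∈ Q := by simp [hQ]
  have hxuv : ∀ w ∈ Q, ∀ k, D.x k u v = ((!(D.T w u v (fs k) ^^ D.T w u v (sn k))) ^^
      (decide (k = e w) ^^ decide (k = f w))) := by
    intro w hw k
    rw [D.x_tri k w u v, D.x_symm (n1 w hw).symm, D.x_symm (n2 w hw).symm, he w hw, hf w hw]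
  have hef : ∀ w ∈ Q, e w ≠ f w := by
    intro w hw
    refine (D1 (D.T w u v) (e w) (f w) ?_).1
    rw [← huv2, D.C_ne huv]
    congr 1; funext k
    exact (hxuv w hw k).symm
  have hcut : ∀ w ∈ Q, ∀ w' ∈ Q, isCut (e w) (f w) (e w') (f w') := by
    intro w hw w' hw'
    have hv : ∀ k, val (e w) (f w) (e w') (f w') k =
        ((D.T w u v (fs k) ^^ D.T w' u v (fs k)) ^^ (D.T w u v (sn k) ^^ D.T w' u v (sn k))) := by
      intro k
      have a := hxuv w hw k
      rw [hxuv w' hw' k] at a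
      unfold val
      revert a
      generalize (decide (k = e w) ^^ decide (k = f w)) = A
      generalize (decide (k = e w') ^^ decide (k = f w')) = B
      generalize D.T w u v (fs k) = A1
      generalize D.T w' u v (fs k) = A2
      generalize D.T w u v (sn k) = A3
      generalize D.T w' u v (sn k) = A4
      clear * -
      revert A B A1 A2 A3 A4
      decide +kernel
    have hg : ∀ a b c : Bool, (b ^^ c) = ((a ^^ b) ^^ (a ^^ c)) := by decide
    unfold isCut
    simp only [hv]
    exact ⟨hg _ _ _, hg _ _ _, hg _ _ _, hg _ _ _, hg _ _ _, hg _ _ _⟩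
  have d2 := dec_D3 _ _ _ _ (hef w₁ m1) (hcut w₁ m1 w₂ m2)
  have d3 := dec_D3 _ _ _ _ (hef w₁ m1) (hcut w₁ m1 w₃ m3)
  by_cases hy : ∃ y, inc (e w₁) y ∧ inc (f w₁) y
  · obtain ⟨y, y1, y2⟩ := hy
    exact cf.noStar m1 m2 m3 h12 h23 h13 y y1 (d2.1 y y1 y2) (d3.1 y y1 y2)
  · have hy' : ∀ y, inc (e w₁) y → ¬ inc (f w₁) y := fun y a b => hy ⟨y, a, b⟩
    have a12 := (cf.d1 _ m1 _ m2 h12).1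
    have a13 := (cf.d1 _ m1 _ m3 h13).1
    have a23 := (cf.d1 _ m2 _ m3 h23).1
    rcases d2.2 hy' with a | a
    · exact a12 a.symm
    rcases d3.2 hy' with b | b
    · exact a13 b.symm
    exact a23 (a.trans b.symm)

theorem main (S : Finset ι) : 2 * (4 * (S.card / 2) * ((S.card - 1) / 2)) ≤ totS D.C S :=
  counting D.C D.C_symm D.C_self D.tri D.noConf _ S rfl

end Dat

end K5n


namespace K5n
open Set

/-- `F` is a continuous logarithm of `f` on `[a,b]`. -/
def IsLift (F f : ℝ → ℂ) (a b : ℝ) : Prop :=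
  ContinuousOn F (Icc a b) ∧ ∀ t ∈ Icc a b, Complex.exp (F t) = f t

open Classical in
/-- Variation of the logarithm. -/
noncomputable def dl (f : ℝ → ℂ) (a b : ℝ) : ℂ :=
  if h : ∃ F, IsLift F f a b then h.choose b - h.choose a else 0

lemma lift_unique {F F' f : ℝ → ℂ} {a b : ℝ} (hab : a ≤ b) (h : IsLift F f a b)
    (h' : IsLift F' f a b) : F b - F a = F' b - F' a := by
  have ha : a ∈ Icc a b := left_mem_Icc.mpr hab
  have hb : b ∈ Icc a b := right_mem_Icc.mpr hab
  have key := Complex.isCoveringMap_exp.eqOn_of_comp_eqOn (s := Icc a b) (g₁ := F)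
    (g₂ := fun t => F' t + (F a - F' a)) isPreconnected_Icc h.1 (h'.1.add continuousOn_const)
    (fun t ht => by
      have e1 := h.2 t ht
      have e2 := h'.2 t ht
      have e3 := h.2 a ha
      have e4 := h'.2 a ha
      have hne : f a ≠ 0 := by rw [← e3]; exact Complex.exp_ne_zero _
      simp only [Function.comp, Subtype.mk.injEq]
      rw [Complex.exp_add, Complex.exp_sub, e1, e2, e3, e4, div_self hne, mul_one]) ha (by ring)
  have := key hb
  simp only at this
  rw [this]; ring

lemma dl_eq {F f : ℝ → ℂ} {a b : ℝ} (hab : a ≤ b) (h : IsLift F f a b) :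
    dl f a b = F b - F a := by
  have hex : ∃ F, IsLift F f a b := ⟨F, h⟩
  rw [dl, dif_pos hex]
  exact lift_unique hab hex.choose_spec h

lemma exists_lift2 {g : ℝ → ℝ → ℂ} {a b c d : ℝ} (hab : a ≤ b) (hcd : c ≤ d)
    (hg : ContinuousOn (fun p : ℝ × ℝ => g p.1 p.2) (Icc a b ×ˢ Icc c d))
    (h0 : ∀ s ∈ Icc a b, ∀ t ∈ Icc c d, g s t ≠ 0) :
    ∃ G : ℝ × ℝ → ℂ, Continuous G ∧
      ∀ s ∈ Icc a b, ∀ t ∈ Icc c d, Complex.exp (G (s, t)) = g s t := by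
  let r : ℝ × ℝ → ℝ × ℝ := fun p => (max a (min b p.1), max c (min d p.2))
  have hr : Continuous r := by fun_prop
  have hm : ∀ p, r p ∈ Icc a b ×ˢ Icc c d := fun p =>
    ⟨⟨le_max_left _ _, max_le hab (min_le_left _ _)⟩, ⟨le_max_left _ _, max_le hcd (min_le_left _ _)⟩⟩
  have hcont : Continuous fun p => g (r p).1 (r p).2 :=
    hg.comp_continuous hr hm
  have hne : ∀ p, g (r p).1 (r p).2 ≠ 0 := fun p => h0 _ (hm p).1 _ (hm p).2
  obtain ⟨G, ⟨-, hG⟩, -⟩ := Complex.isCoveringMapOn_exp.existsUnique_continuousMap_lifts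
    (A := ℝ × ℝ) ⟨fun p => g (r p).1 (r p).2, hcont⟩ (a₀ := (0, 0))
    (Complex.exp_log (hne (0, 0))) hne
  refine ⟨G, G.continuous, fun s hs t ht => ?_⟩
  have h1 := congrFun hG (s, t)
  have h2 : r (s, t) = (s, t) := by
    simp only [r, min_eq_right hs.2, max_eq_right hs.1, min_eq_right ht.2, max_eq_right ht.1]
  simp only [Function.comp, ContinuousMap.coe_mk, h2] at h1
  exact h1

/-- Continuous and non-vanishing. -/
def Nice (f : ℝ → ℂ) (a b : ℝ) : Prop := ContinuousOn f (Icc a b) ∧ ∀ t ∈ Icc a b, f t ≠ 0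

lemma exists_lift {f : ℝ → ℂ} {a b : ℝ} (hab : a ≤ b) (hf : Nice f a b) :
    ∃ F, IsLift F f a b := by
  obtain ⟨G, hG, h⟩ := exists_lift2 (g := fun s _ => f s) (c := 0) (d := 0) hab le_rfl
    (hf.1.comp continuousOn_fst fun p hp => hp.1) fun s hs _ _ => hf.2 s hs
  exact ⟨fun s => G (s, 0), (by fun_prop : Continuous fun s => G (s, 0)).continuousOn,
    fun s hs => h s hs 0 (by simp)⟩

lemma dl_exp {f : ℝ → ℂ} {a b : ℝ} (hab : a ≤ b) (hf : Nice f a b) :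
    Complex.exp (dl f a b) = f b / f a := by
  obtain ⟨F, hF⟩ := exists_lift hab hf
  rw [dl_eq hab hF, Complex.exp_sub, hF.2 b (right_mem_Icc.mpr hab), hF.2 a (left_mem_Icc.mpr hab)]

lemma dl_add {f : ℝ → ℂ} {a b c : ℝ} (hab : a ≤ b) (hbc : b ≤ c) (hf : Nice f a c) :
    dl f a c = dl f a b + dl f b c := by
  obtain ⟨F, hF⟩ := exists_lift (hab.trans hbc) hf
  have h1 : IsLift F f a b := ⟨hF.1.mono (Icc_subset_Icc_right hbc),
    fun t ht => hF.2 t (Icc_subset_Icc_right hbc ht)⟩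
  have h2 : IsLift F f b c := ⟨hF.1.mono (Icc_subset_Icc_left hab),
    fun t ht => hF.2 t (Icc_subset_Icc_left hab ht)⟩
  rw [dl_eq (hab.trans hbc) hF, dl_eq hab h1, dl_eq hbc h2]; ring

lemma dl_const_mul {f g : ℝ → ℂ} {a b : ℝ} (hab : a ≤ b) (hf : Nice f a b) (c : ℂ) (hc : c ≠ 0)
    (hg : ∀ t ∈ Icc a b, g t = c * f t) : dl g a b = dl f a b := by
  obtain ⟨F, hF⟩ := exists_lift hab hf
  have h1 : IsLift (fun t => Complex.log c + F t) g a b :=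
    ⟨continuousOn_const.add hF.1, fun t ht => by
      rw [Complex.exp_add, Complex.exp_log hc, hF.2 t ht, hg t ht]⟩
  rw [dl_eq hab hF, dl_eq hab h1]; ring

lemma dl_neg {f g : ℝ → ℂ} {a b : ℝ} (hab : a ≤ b) (hf : Nice f a b)
    (hg : ∀ t ∈ Icc a b, g t = - f t) : dl g a b = dl f a b :=
  dl_const_mul hab hf (-1) (by simp) fun t ht => by rw [hg t ht]; ring

lemma dl_log {f : ℝ → ℂ} {a b : ℝ} (hab : a ≤ b) (hf : ContinuousOn f (Icc a b))
    (hs : ∀ t ∈ Icc a b, f t ∈ Complex.slitPlane) :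
    dl f a b = Complex.log (f b) - Complex.log (f a) :=
  dl_eq (F := fun t => Complex.log (f t)) hab ⟨hf.clog hs, fun t ht =>
    Complex.exp_log (Complex.slitPlane_ne_zero (hs t ht))⟩

lemma rect {g : ℝ → ℝ → ℂ} {a b c d : ℝ} (hab : a ≤ b) (hcd : c ≤ d)
    (hg : ContinuousOn (fun p : ℝ × ℝ => g p.1 p.2) (Icc a b ×ˢ Icc c d))
    (h0 : ∀ s ∈ Icc a b, ∀ t ∈ Icc c d, g s t ≠ 0) :
    dl (fun s => g s c) a b + dl (fun t => g b t) c d =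
      dl (fun t => g a t) c d + dl (fun s => g s d) a b := by
  obtain ⟨G, hG, h⟩ := exists_lift2 hab hcd hg h0
  have ha : a ∈ Icc a b := left_mem_Icc.mpr hab
  have hb : b ∈ Icc a b := right_mem_Icc.mpr hab
  have hc : c ∈ Icc c d := left_mem_Icc.mpr hcd
  have hd : d ∈ Icc c d := right_mem_Icc.mpr hcd
  have c1 : ∀ t, Continuous fun s => G (s, t) := fun t => by fun_prop
  have c2 : ∀ s, Continuous fun t => G (s, t) := fun t => by fun_prop
  rw [dl_eq (F := fun s => G (s, c)) hab ⟨(c1 c).continuousOn, fun s hs => h s hs c hc⟩,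
    dl_eq (F := fun s => G (s, d)) hab ⟨(c1 d).continuousOn, fun s hs => h s hs d hd⟩,
    dl_eq (F := fun t => G (a, t)) hcd ⟨(c2 a).continuousOn, fun t ht => h a ha t ht⟩,
    dl_eq (F := fun t => G (b, t)) hcd ⟨(c2 b).continuousOn, fun t ht => h b hb t ht⟩]
  ring

lemma slit_scale {w : ℂ} (hw : w ∈ Complex.slitPlane) {r q : ℝ} (hr : 0 ≤ r) (hq : 0 ≤ q)
    (h : 0 < r + q) : (q : ℂ) + r * w ∈ Complex.slitPlane := by
  rw [Complex.mem_slitPlane_iff] at hw ⊢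
  simp only [Complex.add_re, Complex.mul_re, Complex.ofReal_re, Complex.ofReal_im, zero_mul,
    sub_zero, Complex.add_im, Complex.mul_im, add_zero, zero_add]
  rcases hr.eq_or_lt with h0 | h0
  · left; rw [← h0]; linarith
  rcases hw with hw | hw
  · left; positivity
  · right; exact mul_ne_zero h0.ne' hw

/-- The local sign computation. -/
lemma log_sign {x y : ℂ} (hx : x ≠ 0) (hy : y ≠ 0) (h : x.arg < y.arg) :
    Complex.log (-y / x) = Complex.log y - Complex.log x - Real.pi * Complex.I := by
  have e : Complex.exp (Complex.log y - Complex.log x - Real.pi * Complex.I) = -y / x := by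
    rw [Complex.exp_sub, Complex.exp_sub, Complex.exp_log hx, Complex.exp_log hy,
      Complex.exp_pi_mul_I]
    ring
  rw [← e, Complex.log_exp]
  · simp [Complex.log_im]; linarith
  · simp [Complex.log_im]
    have := Complex.arg_le_pi y
    have := Complex.neg_pi_lt_arg x
    linarith

lemma log_sign' {x y : ℂ} (hx : x ≠ 0) (hy : y ≠ 0) (h : y.arg < x.arg) :
    Complex.log (-y / x) = Complex.log y - Complex.log x + Real.pi * Complex.I := by
  have e : Complex.exp (Complex.log y - Complex.log x + Real.pi * Complex.I) = -y / x := by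
    rw [Complex.exp_add, Complex.exp_sub, Complex.exp_log hx, Complex.exp_log hy,
      Complex.exp_pi_mul_I]
    ring
  rw [← e, Complex.log_exp]
  · simp [Complex.log_im]
    have := Complex.arg_le_pi x
    have := Complex.neg_pi_lt_arg y
    linarith
  · simp [Complex.log_im]; linarith

end K5n


namespace K5n
open Set

lemma kappa {p q : ℝ → ℂ} {P u v : ℂ} (hp : ContinuousOn p (Icc 0 1))
    (hq : ContinuousOn q (Icc 0 1)) (hu : u ≠ 0) 
    (hpl : ∀ s ∈ Icc (0 : ℝ) (1 / 2), p s = P + 2 * s * u)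
    (hql : ∀ s ∈ Icc (0 : ℝ) (1 / 2), q s = P + 2 * s * v)
    (hw : -v / u ∈ Complex.slitPlane)
    (hs : ∀ s ∈ Icc (0 : ℝ) 1, ∀ t ∈ Icc (0 : ℝ) 1, p s = q t → s = 0 ∧ t = 0) :
    dl (fun t => q t - p 1) 0 1 - dl (fun s => p s - q 1) 0 1 + dl (fun s => p s - P) (1 / 2) 1
      - dl (fun t => q t - P) (1 / 2) 1 = Complex.log (-v / u) := by
  have i1 : Icc (0 : ℝ) (1 / 2) ⊆ Icc 0 1 := Icc_subset_Icc_right (by norm_num)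
  have i2 : Icc (1 / 2 : ℝ) 1 ⊆ Icc 0 1 := Icc_subset_Icc_left (by norm_num)
  have hh : (1 / 2 : ℝ) ≤ 1 := by norm_num
  have h0 : (0 : ℝ) ≤ 1 / 2 := by norm_num
  have m1 : (1 : ℝ) ∈ Icc (0 : ℝ) 1 := by simp
  have m0 : (0 : ℝ) ∈ Icc (0 : ℝ) 1 := by simp
  have mh : (1 / 2 : ℝ) ∈ Icc (0 : ℝ) 1 := by norm_num
  have hp0 : p 0 = P := by rw [hpl 0 (by simp)]; simp
  have hq0 : q 0 = P := by rw [hql 0 (by simp)]; simp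
  have hph : p (1 / 2) = P + u := by rw [hpl _ (by norm_num)]; push_cast; ring
  have hqh : q (1 / 2) = P + v := by rw [hql _ (by norm_num)]; push_cast; ring
  set g : ℝ → ℝ → ℂ := fun s t => p s - q t with hg
  have gc : ContinuousOn (fun x : ℝ × ℝ => g x.1 x.2) (Icc 0 1 ×ˢ Icc 0 1) :=
    (hp.comp continuousOn_fst fun x hx => hx.1).sub (hq.comp continuousOn_snd fun x hx => hx.2)
  have gne : ∀ s ∈ Icc (0 : ℝ) 1, ∀ t ∈ Icc (0 : ℝ) 1, (s ≠ 0 ∨ t ≠ 0) → g s t ≠ 0 := by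
    intro s hs' t ht hne h
    have := hs s hs' t ht (sub_eq_zero.mp h)
    tauto
  have hpos : ∀ s ∈ Icc (1 / 2 : ℝ) 1, s ≠ 0 := fun s h => by have := h.1; linarith
  have r1 := rect (g := g) hh h0 (gc.mono (prod_mono i2 i1)) fun s a t b =>
    gne s (i2 a) t (i1 b) (Or.inl (hpos s a))
  have r2 := rect (g := g) hh hh (gc.mono (prod_mono i2 i2)) fun s a t b =>
    gne s (i2 a) t (i2 b) (Or.inl (hpos s a))
  have r3 := rect (g := g) h0 hh (gc.mono (prod_mono i1 i2)) fun s a t b =>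
    gne s (i1 a) t (i2 b) (Or.inr (hpos t b))
  have v1 : dl (fun t => g 1 t) 0 1 = dl (fun t => q t - p 1) 0 1 := by
    refine dl_neg zero_le_one ⟨hq.sub continuousOn_const, fun t ht h => ?_⟩ fun t ht => ?_
    · exact gne 1 m1 t ht (by simp) (by simp only [hg]; linear_combination -h)
    · simp only [hg]; ring
  have v1a : dl (fun t => g 1 t) 0 1 = dl (fun t => g 1 t) 0 (1 / 2) + dl (fun t => g 1 t) (1 / 2) 1 :=
    dl_add h0 hh ⟨continuousOn_const.sub hq, fun t ht => gne 1 m1 t ht (by simp)⟩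
  have h1a : dl (fun s => g s 1) 0 1 = dl (fun s => g s 1) 0 (1 / 2) + dl (fun s => g s 1) (1 / 2) 1 :=
    dl_add h0 hh ⟨hp.sub continuousOn_const, fun t ht => gne t ht 1 m1 (by simp)⟩
  have v0 : dl (fun t => g 0 t) (1 / 2) 1 = dl (fun t => q t - P) (1 / 2) 1 := by
    refine dl_neg hh ⟨(hq.mono i2).sub continuousOn_const, fun t ht h => ?_⟩ fun t ht => ?_
    · exact gne 0 m0 t (i2 ht) (Or.inr (hpos t ht)) (by simp only [hg, hp0]; linear_combination -h)
    · simp only [hg, hp0]; ring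
  have h0' : (fun s => g s 0) = fun s => p s - P := by funext s; simp only [hg, hq0]
  have vh : dl (fun t => g (1 / 2) t) 0 (1 / 2) = Complex.log (1 + -v / u) := by
    have sl : ∀ t ∈ Icc (0 : ℝ) (1 / 2), ((1 : ℝ) : ℂ) + (2 * t : ℝ) * (-v / u) ∈ Complex.slitPlane :=
      fun t ht => slit_scale hw (by linarith [ht.1]) zero_le_one (by linarith [ht.1])
    have cc : ContinuousOn (fun t : ℝ => ((1 : ℝ) : ℂ) + (2 * t : ℝ) * (-v / u)) (Icc 0 (1 / 2)) := by
      fun_prop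
    rw [dl_const_mul (f := fun t : ℝ => ((1 : ℝ) : ℂ) + (2 * t : ℝ) * (-v / u)) h0
      ⟨cc, fun t ht => Complex.slitPlane_ne_zero (sl t ht)⟩ u hu, dl_log h0 cc sl]
    · norm_num
    · intro t ht
      simp only [hg]
      rw [hph, hql t ht]
      field_simp
      push_cast
      ring
  have hhf : dl (fun s => g s (1 / 2)) 0 (1 / 2) =
      Complex.log (1 + -v / u) - Complex.log (-v / u) := by
    have sl : ∀ t ∈ Icc (0 : ℝ) (1 / 2), ((2 * t : ℝ) : ℂ) + (1 : ℝ) * (-v / u) ∈ Complex.slitPlane :=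
      fun t ht => slit_scale hw zero_le_one (by linarith [ht.1]) (by linarith [ht.1])
    have cc : ContinuousOn (fun t : ℝ => ((2 * t : ℝ) : ℂ) + (1 : ℝ) * (-v / u)) (Icc 0 (1 / 2)) := by
      fun_prop
    rw [dl_const_mul (f := fun t : ℝ => ((2 * t : ℝ) : ℂ) + (1 : ℝ) * (-v / u)) h0
      ⟨cc, fun t ht => Complex.slitPlane_ne_zero (sl t ht)⟩ u hu, dl_log h0 cc sl]
    · norm_num
    · intro t ht
      simp only [hg]
      rw [hqh, hpl t ht]
      field_simp
      push_cast
      ring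
  have h1 : dl (fun s => g s 1) 0 1 = dl (fun s => p s - q 1) 0 1 := rfl
  rw [h0'] at r1
  linear_combination r1 + r2 + r3 - v1 + v1a + h1 - h1a + v0 + vh - hhf

/-- A system of arcs straightened near the five vertices. -/
structure Sys (ι : Type*) where
  P : Fin 5 → ℂ
  Q : ι → ℂ
  η : Fin 5 → ι → ℝ → ℂ
  u : Fin 5 → ι → ℂ
  cont : ∀ a i, ContinuousOn (η a i) (Icc 0 1)
  one : ∀ a i, η a i 1 = Q i
  lin : ∀ a i, ∀ s ∈ Icc (0 : ℝ) (1 / 2), η a i s = P a + 2 * s * u a i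
  ne : ∀ a i, u a i ≠ 0
  star : ∀ a i j, i ≠ j → ∀ s ∈ Icc (0 : ℝ) 1, ∀ t ∈ Icc (0 : ℝ) 1, η a i s = η a j t → s = 0 ∧ t = 0
  own : ∀ a i, ∀ s ∈ Icc (0 : ℝ) 1, η a i s = P a → s = 0
  oth : ∀ a b i, a ≠ b → ∀ s ∈ Icc (0 : ℝ) 1, η a i s ≠ P b

namespace Sys
variable {ι : Type*} (S : Sys ι)

lemma zero (a : Fin 5) (i : ι) : S.η a i 0 = S.P a := by rw [S.lin a i 0 (by simp)]; simp

lemma arg_ne (a : Fin 5) {i j : ι} (h : i ≠ j) : (S.u a i).arg ≠ (S.u a j).arg := by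
  intro he
  rw [Complex.arg_eq_arg_iff (S.ne a i) (S.ne a j)] at he
  have n1 := norm_pos_iff.mpr (S.ne a i)
  have n2 := norm_pos_iff.mpr (S.ne a j)
  set x := ‖S.u a i‖
  set y := ‖S.u a j‖
  have hxy : 0 < x + y := by positivity
  have m1 : y / (x + y) / 2 ∈ Icc (0 : ℝ) (1 / 2) := by
    constructor
    · positivity
    · have : y / (x + y) ≤ 1 := by rw [div_le_one hxy]; linarith
      linarith
  have m2 : x / (x + y) / 2 ∈ Icc (0 : ℝ) (1 / 2) := by
    constructor
    · positivity
    · have : x / (x + y) ≤ 1 := by rw [div_le_one hxy]; linarith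
      linarith
  have i1 : Icc (0 : ℝ) (1 / 2) ⊆ Icc 0 1 := Icc_subset_Icc_right (by norm_num)
  have hx0 : (x : ℂ) ≠ 0 := by exact_mod_cast n1.ne'
  have hs0 : (x : ℂ) + y ≠ 0 := by exact_mod_cast hxy.ne'
  have := (S.star a i j h _ (i1 m1) _ (i1 m2) (by
    rw [S.lin a i _ m1, S.lin a j _ m2, ← he]
    push_cast
    field_simp)).1
  have h3 : 0 < y / (x + y) / 2 := by positivity
  linarith

lemma slit (a : Fin 5) {i j : ι} (h : i ≠ j) : -S.u a j / S.u a i ∈ Complex.slitPlane := by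
  rw [Complex.mem_slitPlane_iff_arg]
  refine ⟨fun hpi => ?_, div_ne_zero (neg_ne_zero.mpr (S.ne a j)) (S.ne a i)⟩
  have hlog : (Complex.log (-S.u a j / S.u a i)).im = Real.pi := by rw [Complex.log_im, hpi]
  rcases lt_or_gt_of_ne (S.arg_ne a h) with h' | h'
  · rw [log_sign (S.ne a i) (S.ne a j) h'] at hlog
    simp [Complex.log_im] at hlog
    have := Complex.arg_le_pi (S.u a j)
    have := Complex.neg_pi_lt_arg (S.u a i)
    linarith
  · rw [log_sign' (S.ne a i) (S.ne a j) h'] at hlog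
    simp [Complex.log_im] at hlog
    linarith

/-- Variation of the argument of the arc around `z`. -/
noncomputable def A (a : Fin 5) (i : ι) (z : ℂ) : ℂ := dl (fun s => S.η a i s - z) 0 1

/-- A logarithm of `Q i - P a`. -/
noncomputable def al (a : Fin 5) (i : ι) : ℂ :=
  Complex.log (S.u a i) + dl (fun s => S.η a i s - S.P a) (1 / 2) 1

open Classical in
/-- Rotation order. -/
noncomputable def lt (a : Fin 5) (i j : ι) : Bool := decide ((S.u a i).arg < (S.u a j).arg)

lemma kap (a : Fin 5) {i j : ι} (h : i ≠ j) :
    S.A a j (S.Q i) - S.A a i (S.Q j) + S.al a i - S.al a j =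
      if S.lt a i j then -(Real.pi * Complex.I) else Real.pi * Complex.I := by
  have k := kappa (S.cont a i) (S.cont a j) (S.ne a i) (S.lin a i) (S.lin a j) (S.slit a h)
    (S.star a i j h)
  unfold A al
  simp only [S.one] at k
  rcases lt_or_gt_of_ne (S.arg_ne a h) with h' | h'
  · rw [log_sign (S.ne a i) (S.ne a j) h'] at k
    have : S.lt a i j = true := by simp [lt, h']
    rw [if_pos this]
    linear_combination k
  · rw [log_sign' (S.ne a i) (S.ne a j) h'] at k
    have : ¬ (S.lt a i j = true) := by simp [lt, h'.le]
    rw [if_neg this]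
    linear_combination k

/-- The linking quantity. -/
noncomputable def L (a b : Fin 5) (i j : ι) : ℂ :=
  S.A a i (S.P b) + S.A b j (S.Q i) - S.A a i (S.Q j) - S.A b j (S.P a)

/-- Two arcs meet. -/
def Meet (a b : Fin 5) (i j : ι) : Prop :=
  ∃ s ∈ Icc (0 : ℝ) 1, ∃ t ∈ Icc (0 : ℝ) 1, S.η a i s = S.η b j t

lemma L_zero {a b : Fin 5} {i j : ι} (h : ¬ S.Meet a b i j) : S.L a b i j = 0 := by
  have hne : ∀ s ∈ Icc (0 : ℝ) 1, ∀ t ∈ Icc (0 : ℝ) 1, S.η a i s - S.η b j t ≠ 0 :=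
    fun s hs t ht he => h ⟨s, hs, t, ht, sub_eq_zero.mp he⟩
  have m1 : (1 : ℝ) ∈ Icc (0 : ℝ) 1 := by simp
  have m0 : (0 : ℝ) ∈ Icc (0 : ℝ) 1 := by simp
  have r := rect (g := fun s t => S.η a i s - S.η b j t) zero_le_one zero_le_one
    (((S.cont a i).comp continuousOn_fst fun x hx => hx.1).sub
      ((S.cont b j).comp continuousOn_snd fun x hx => hx.2)) hne
  simp only [S.zero, S.one] at r
  have e1 : dl (fun t => S.Q i - S.η b j t) 0 1 = S.A b j (S.Q i) :=
    dl_neg zero_le_one ⟨(S.cont b j).sub continuousOn_const, fun t ht h => by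
      have := hne 1 m1 t ht
      rw [S.one] at this
      exact this (by linear_combination -h)⟩ fun t _ => by ring
  have e2 : dl (fun t => S.P a - S.η b j t) 0 1 = S.A b j (S.P a) :=
    dl_neg zero_le_one ⟨(S.cont b j).sub continuousOn_const, fun t ht h => by
      have := hne 0 m0 t ht
      rw [S.zero] at this
      exact this (by linear_combination -h)⟩ fun t _ => by ring
  rw [e1, e2] at r
  unfold L
  unfold A at *
  linear_combination r

/-- The vertex term. -/
noncomputable def M (a b : Fin 5) (i : ι) : ℂ :=
  S.A a i (S.P b) + S.A b i (S.P a) - S.al a i - S.al b i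

lemma L_sub {a b : Fin 5} {i j : ι} (hij : i ≠ j) : S.L a b i j - S.L a b j i =
    (if S.lt a i j then -(Real.pi * Complex.I) else Real.pi * Complex.I) +
    (if S.lt b i j then -(Real.pi * Complex.I) else Real.pi * Complex.I) +
    S.M a b i - S.M a b j := by
  rw [← S.kap a hij, ← S.kap b hij]
  unfold L M
  ring

lemma exp_al (a : Fin 5) (i : ι) : Complex.exp (S.al a i) = S.Q i - S.P a := by
  have i2 : Icc (1 / 2 : ℝ) 1 ⊆ Icc 0 1 := Icc_subset_Icc_left (by norm_num)
  unfold al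
  rw [Complex.exp_add, Complex.exp_log (S.ne a i), dl_exp (by norm_num), S.one,
    S.lin a i (1 / 2) (by norm_num)]
  · have h := S.ne a i
    have e : S.P a + 2 * ((1 / 2 : ℝ) : ℂ) * S.u a i - S.P a = S.u a i := by push_cast; ring
    rw [e]
    field_simp
  · refine ⟨((S.cont a i).mono i2).sub continuousOn_const, fun t ht h => ?_⟩
    have := S.own a i t (i2 ht) (sub_eq_zero.mp h)
    have := ht.1
    linarith

lemma exp_M {a b : Fin 5} (hab : a ≠ b) (i : ι) :
    Complex.exp (S.M a b i) = -1 / (S.P a - S.P b) ^ 2 := by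
  have m0 : (0 : ℝ) ∈ Icc (0 : ℝ) 1 := by simp
  have m1 : (1 : ℝ) ∈ Icc (0 : ℝ) 1 := by simp
  have e1 : Complex.exp (S.A a i (S.P b)) = (S.Q i - S.P b) / (S.P a - S.P b) := by
    unfold A
    rw [dl_exp zero_le_one, S.one, S.zero]
    exact ⟨(S.cont a i).sub continuousOn_const, fun t ht h => S.oth a b i hab t ht (sub_eq_zero.mp h)⟩
  have e2 : Complex.exp (S.A b i (S.P a)) = (S.Q i - S.P a) / (S.P b - S.P a) := by
    unfold A
    rw [dl_exp zero_le_one, S.one, S.zero]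
    exact ⟨(S.cont b i).sub continuousOn_const,
      fun t ht h => S.oth b a i hab.symm t ht (sub_eq_zero.mp h)⟩
  have n1 : S.P a - S.P b ≠ 0 := fun h => S.oth a b i hab 0 m0 (by
    rw [S.zero]; exact sub_eq_zero.mp h)
  have n2 : S.P b - S.P a ≠ 0 := fun h => n1 (by linear_combination -h)
  have n3 : S.Q i - S.P a ≠ 0 := fun h => S.oth b a i hab.symm 1 m1 (by
    rw [S.one]; exact sub_eq_zero.mp h)
  have n4 : S.Q i - S.P b ≠ 0 := fun h => S.oth a b i hab 1 m1 (by
    rw [S.one]; exact sub_eq_zero.mp h)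
  unfold M
  rw [Complex.exp_sub, Complex.exp_sub, Complex.exp_add, S.exp_al, S.exp_al, e1, e2]
  field_simp
  ring

lemma exists_m (k : Fin 10) (i : ι) : ∃ m : ℤ, S.M (fs k) (sn k) i =
    Complex.log (-1 / (S.P (fs k) - S.P (sn k)) ^ 2) + m * (2 * Real.pi * Complex.I) := by
  have hk : fs k ≠ sn k := by revert k; decide
  rw [← Complex.exp_eq_exp_iff_exists_int, S.exp_M hk, Complex.exp_log]
  rw [← S.exp_M hk i]; exact Complex.exp_ne_zero _

/-- Integer part of the vertex term. -/
noncomputable def m (k : Fin 10) (i : ι) : ℤ := (S.exists_m k i).choose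

/-- The combinatorial data. -/
noncomputable def dat : Dat ι where
  lt := S.lt
  mb k i := decide (S.m k i % 2 = 1)
  anti a i j h := by
    rcases lt_or_gt_of_ne (S.arg_ne a h) with h' | h'
    · simp [lt, h', h'.le]
    · simp [lt, h', h'.le]
  trans a i j l _ _ _ h1 h2 := by
    simp only [lt, decide_eq_true_eq] at *
    exact h1.trans h2

theorem meet_of_x (k : Fin 10) {i j : ι} (hij : i ≠ j) (hx : S.dat.x k i j = true) :
    S.Meet (fs k) (sn k) i j ∨ S.Meet (fs k) (sn k) j i := by
  by_contra hcon
  push Not at hcon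
  have h := S.L_sub (a := fs k) (b := sn k) hij
  rw [S.L_zero hcon.1, S.L_zero hcon.2] at h
  have mi := (S.exists_m k i).choose_spec
  have mj := (S.exists_m k j).choose_spec
  change _ = _ + (S.m k i : ℂ) * _ at mi
  change _ = _ + (S.m k j : ℂ) * _ at mj
  rw [mi, mj] at h
  have hpi : (Real.pi : ℂ) * Complex.I ≠ 0 :=
    mul_ne_zero (by exact_mod_cast Real.pi_ne_zero) Complex.I_ne_zero
  simp only [Dat.x, dat] at hx
  cases ha : S.lt (fs k) i j <;> cases hb : S.lt (sn k) i j <;>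
    simp only [ha, hb, if_true, if_false, Bool.false_eq_true] at h hx
  · have h2 : ((1 + S.m k i - S.m k j : ℤ) : ℂ) = 0 := by
      apply mul_left_cancel₀ (mul_ne_zero two_ne_zero hpi)
      push_cast
      linear_combination -h
    have h3 : 1 + S.m k i - S.m k j = 0 := by exact_mod_cast h2
    revert hx
    by_cases q1 : S.m k i % 2 = 1 <;> by_cases q2 : S.m k j % 2 = 1 <;> simp [q1, q2] <;> omega
  · have h2 : ((S.m k i - S.m k j : ℤ) : ℂ) = 0 := by
      apply mul_left_cancel₀ (mul_ne_zero two_ne_zero hpi)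
      push_cast
      linear_combination -h
    have h3 : S.m k i - S.m k j = 0 := by exact_mod_cast h2
    revert hx
    by_cases q1 : S.m k i % 2 = 1 <;> by_cases q2 : S.m k j % 2 = 1 <;> simp [q1, q2] <;> omega
  · have h2 : ((S.m k i - S.m k j : ℤ) : ℂ) = 0 := by
      apply mul_left_cancel₀ (mul_ne_zero two_ne_zero hpi)
      push_cast
      linear_combination -h
    have h3 : S.m k i - S.m k j = 0 := by exact_mod_cast h2
    revert hx
    by_cases q1 : S.m k i % 2 = 1 <;> by_cases q2 : S.m k j % 2 = 1 <;> simp [q1, q2] <;> omega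
  · have h2 : ((-1 + S.m k i - S.m k j : ℤ) : ℂ) = 0 := by
      apply mul_left_cancel₀ (mul_ne_zero two_ne_zero hpi)
      push_cast
      linear_combination -h
    have h3 : -1 + S.m k i - S.m k j = 0 := by exact_mod_cast h2
    revert hx
    by_cases q1 : S.m k i % 2 = 1 <;> by_cases q2 : S.m k j % 2 = 1 <;> simp [q1, q2] <;> omega

end Sys

end K5n


namespace K5n
open Set

/-- First straightening parameter. -/
lemma exists_last {γ : ℝ → ℂ} {P : ℂ} {r : ℝ} (hr : 0 < r) (hc : ContinuousOn γ (Icc 0 1))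
    (h0 : γ 0 = P) (h1 : r < ‖γ 1 - P‖) :
    ∃ s₀ : ℝ, 0 < s₀ ∧ s₀ < 1 ∧ ‖γ s₀ - P‖ = r ∧ ∀ t ∈ Icc (0 : ℝ) 1, ‖γ t - P‖ ≤ r → t ≤ s₀ := by
  have hf : ContinuousOn (fun t => ‖γ t - P‖) (Icc 0 1) := (hc.sub continuousOn_const).norm
  have hK : IsCompact (Icc (0 : ℝ) 1 ∩ (fun t => ‖γ t - P‖) ⁻¹' Iic r) := by
    refine isCompact_Icc.of_isClosed_subset (hf.preimage_isClosed_of_isClosed isClosed_Icc isClosed_Iic)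
      inter_subset_left
  obtain ⟨s, ⟨hs, hsr⟩, hmax⟩ := hK.exists_isGreatest ⟨0, by simp [h0, hr.le]⟩
  have hmax' : ∀ t ∈ Icc (0 : ℝ) 1, ‖γ t - P‖ ≤ r → t ≤ s := fun t ht h => hmax ⟨ht, h⟩
  have hiv := intermediate_value_Icc hs.2 (hf.mono (Icc_subset_Icc_left hs.1))
  obtain ⟨t, ht, he⟩ := hiv ⟨hsr, h1.le⟩
  have hts : t = s := le_antisymm (hmax' t ⟨hs.1.trans ht.1, ht.2⟩ he.le) ht.1
  rw [hts] at he
  refine ⟨s, lt_of_le_of_ne hs.1 ?_, lt_of_le_of_ne hs.2 ?_, he, hmax'⟩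
  · rintro rfl
    simp [h0] at he
    exact hr.ne he
  · rintro rfl
    simp only at he
    exact absurd he h1.ne'

/-- Raw arcs. -/
structure Raw (ι : Type*) where
  P : Fin 5 → ℂ
  Q : ι → ℂ
  γ : Fin 5 → ι → ℝ → ℂ
  cont : ∀ a i, ContinuousOn (γ a i) (Icc 0 1)
  zero : ∀ a i, γ a i 0 = P a
  one : ∀ a i, γ a i 1 = Q i
  inj : ∀ a i, InjOn (γ a i) (Icc 0 1)
  star : ∀ a i j, i ≠ j → ∀ s ∈ Icc (0 : ℝ) 1, ∀ t ∈ Icc (0 : ℝ) 1, γ a i s = γ a j t →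
    γ a i s = P a ∨ γ a i s = Q i
  oth : ∀ a b i, a ≠ b → ∀ s ∈ Icc (0 : ℝ) 1, γ a i s ≠ P b
  othQ : ∀ a i j, i ≠ j → ∀ s ∈ Icc (0 : ℝ) 1, γ a i s ≠ Q j

namespace Raw
variable {ι : Type*} (R : Raw ι)

lemma exists_r [Finite ι] : ∃ r : ℝ, 0 < r ∧ ∀ a b i, a ≠ b → ∀ t ∈ Icc (0 : ℝ) 1,
    2 * r < ‖R.γ a i t - R.P b‖ := by
  have h : ∀ᶠ r in nhdsWithin (0 : ℝ) (Ioi 0), ∀ a b i, a ≠ b → ∀ t ∈ Icc (0 : ℝ) 1,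
      2 * r < ‖R.γ a i t - R.P b‖ := by
    rw [Filter.eventually_all]; intro a
    rw [Filter.eventually_all]; intro b
    rw [Filter.eventually_all]; intro i
    by_cases hab : a = b
    · exact Filter.Eventually.of_forall fun _ h => absurd hab h
    have hf : ContinuousOn (fun t => ‖R.γ a i t - R.P b‖) (Icc 0 1) :=
      ((R.cont a i).sub continuousOn_const).norm
    obtain ⟨t₀, ht₀, hmin⟩ := isCompact_Icc.exists_isMinOn (by simp : (Icc (0 : ℝ) 1).Nonempty) hf
    have hpos : 0 < ‖R.γ a i t₀ - R.P b‖ :=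
      norm_pos_iff.mpr (sub_ne_zero.mpr (R.oth a b i hab t₀ ht₀))
    have : ∀ᶠ r in nhdsWithin (0 : ℝ) (Ioi 0), r < ‖R.γ a i t₀ - R.P b‖ / 2 :=
      Filter.Eventually.filter_mono nhdsWithin_le_nhds (gt_mem_nhds (half_pos hpos))
    filter_upwards [this] with r hr _ t ht
    have := hmin ht
    simp only [mem_setOf_eq] at this
    linarith
  obtain ⟨r, h1, h2⟩ := (h.and self_mem_nhdsWithin).exists
  exact ⟨r, h2, h1⟩

theorem straighten [Finite ι] : ∃ S : Sys ι, ∀ a b i j, a ≠ b → S.Meet a b i j →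
    ∃ s ∈ Icc (0 : ℝ) 1, ∃ t ∈ Icc (0 : ℝ) 1, R.γ a i s = R.γ b j t := by
  obtain ⟨r, hr, hfar⟩ := R.exists_r
  have hstar : ∀ a i j, i ≠ j → ∀ s ∈ Icc (0 : ℝ) 1, ∀ t ∈ Icc (0 : ℝ) 1,
      R.γ a i s = R.γ a j t → s = 0 := by
    intro a i j hij s hs t ht he
    rcases R.star a i j hij s hs t ht he with h | h
    · exact R.inj a i hs (by simp) (h.trans (R.zero a i).symm)
    · exact absurd (he ▸ h) (R.othQ a j i hij.symm t ht)
  have h1 : ∀ a i, r < ‖R.γ a i 1 - R.P a‖ := by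
    intro a i
    obtain ⟨b, hb⟩ := exists_ne a
    have := hfar b a i hb 1 (by simp)
    rw [R.one] at this ⊢
    linarith
  choose s₀ hs0 hs1 hsr hsm using fun a i => exists_last hr (R.cont a i) (R.zero a i) (h1 a i)
  have hms : ∀ a i, s₀ a i ∈ Icc (0 : ℝ) 1 := fun a i => ⟨(hs0 a i).le, (hs1 a i).le⟩
  set u : Fin 5 → ι → ℂ := fun a i => R.γ a i (s₀ a i) - R.P a with hu
  set τ : Fin 5 → ι → ℝ → ℝ := fun a i s => s₀ a i + (2 * max s (1 / 2) - 1) * (1 - s₀ a i) with hτ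
  set η : Fin 5 → ι → ℝ → ℂ := fun a i s => R.P a + 2 * (min s (1 / 2) : ℝ) * u a i +
    (R.γ a i (τ a i s) - R.γ a i (s₀ a i)) with hη
  have hτm : ∀ a i, ∀ s ∈ Icc (0 : ℝ) 1, τ a i s ∈ Icc (0 : ℝ) 1 ∧ s₀ a i ≤ τ a i s := by
    intro a i s hs
    have q1 : 0 ≤ 2 * max s (1 / 2) - 1 := by have := le_max_right s (1 / 2); linarith
    have q2 : 2 * max s (1 / 2) - 1 ≤ 1 := by
      have := max_le hs.2 (by norm_num : (1 / 2 : ℝ) ≤ 1); linarith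
    have q3 := hs1 a i
    have q4 := hs0 a i
    have q5 : 0 ≤ (2 * max s (1 / 2) - 1) * (1 - s₀ a i) := mul_nonneg q1 (by linarith)
    have q6 : (2 * max s (1 / 2) - 1) * (1 - s₀ a i) ≤ 1 * (1 - s₀ a i) :=
      mul_le_mul_of_nonneg_right q2 (by linarith)
    simp only [hτ]
    refine ⟨⟨by linarith, by linarith⟩, by linarith⟩
  have lin : ∀ a i, ∀ s : ℝ, s ≤ 1 / 2 → η a i s = R.P a + 2 * s * u a i := by
    intro a i s hs
    have : τ a i s = s₀ a i := by simp only [hτ, max_eq_right hs]; ring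
    simp only [hη, this, min_eq_left hs]; ring
  have tail : ∀ a i, ∀ s : ℝ, 1 / 2 ≤ s → η a i s = R.γ a i (τ a i s) := by
    intro a i s hs
    simp only [hη, min_eq_right hs, hu]; push_cast; ring
  have une : ∀ a i, u a i ≠ 0 := fun a i h => by
    have := hsr a i
    simp only [hu] at h
    rw [h, norm_zero] at this
    exact hr.ne this
  have un : ∀ a i, ‖u a i‖ = r := hsr
  have linnorm : ∀ a i, ∀ s ∈ Icc (0 : ℝ) 1, s ≤ 1 / 2 → ‖η a i s - R.P a‖ = 2 * s * r := by
    intro a i s hs h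
    rw [lin a i s h, add_sub_cancel_left, norm_mul, un, norm_mul]
    simp [abs_of_nonneg hs.1]
  have uinj : ∀ a i j, i ≠ j → u a i ≠ u a j := by
    intro a i j hij h
    have := hstar a i j hij _ (hms a i) _ (hms a j) (by simpa [hu] using h)
    exact (hs0 a i).ne' this
  have mixed : ∀ a i j, i ≠ j → ∀ s ∈ Icc (0 : ℝ) 1, ∀ t ∈ Icc (0 : ℝ) 1, s ≤ 1 / 2 → 1 / 2 ≤ t →
      η a i s = η a j t → False := by
    intro a i j hij s hs t ht hs' ht' he
    have n1 := linnorm a i s hs hs'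
    have e1 := tail a j t ht'
    obtain ⟨q1, q2⟩ := hτm a j t ht
    have n2 : ‖R.γ a j (τ a j t) - R.P a‖ ≤ r := by
      rw [← e1, ← he, n1]; nlinarith
    have hts : τ a j t = s₀ a j := le_antisymm (hsm a j _ q1 n2) q2
    rw [hts] at e1
    have hs2 : 2 * s * r = r := by rw [← n1, he, e1]; exact un a j
    have hs3 : s = 1 / 2 := by
      have : (2 * s - 1) * r = 0 := by linarith
      rcases mul_eq_zero.mp this with h | h
      · linarith
      · exact absurd h hr.ne'
    apply uinj a i j hij
    have e2 := lin a i s hs'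
    rw [he, e1, hs3] at e2
    simp only [hu] at e2 ⊢
    push_cast at e2
    linear_combination -e2
  refine ⟨{ P := R.P, Q := R.Q, η := η, u := u, cont := ?_, one := ?_, lin := ?_, ne := une,
            star := ?_, own := ?_, oth := ?_ }, ?_⟩
  · intro a i
    have c1 : Continuous (τ a i) := by simp only [hτ]; fun_prop
    have c2 : ContinuousOn (fun s => R.γ a i (τ a i s)) (Icc 0 1) :=
      (R.cont a i).comp c1.continuousOn fun s hs => (hτm a i s hs).1
    have c3 : Continuous fun s : ℝ => R.P a + 2 * (min s (1 / 2) : ℝ) * u a i := by fun_prop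
    exact c3.continuousOn.add (c2.sub continuousOn_const)
  · intro a i
    rw [tail a i 1 (by norm_num), ← R.one a i]
    congr 1
    have : max (1 : ℝ) (1 / 2) = 1 := by norm_num
    simp only [hτ, this]; ring
  · exact fun a i s hs => lin a i s hs.2
  · intro a i j hij s hs t ht he
    rcases le_total s (1 / 2) with h | h <;> rcases le_total t (1 / 2) with h' | h'
    · have n1 := linnorm a i s hs h
      have n2 := linnorm a j t ht h'
      rw [he, n2] at n1
      have hst : s = t := by
        have : (s - t) * r = 0 := by linarith
        rcases mul_eq_zero.mp this with h | h
        · linarith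
        · exact absurd h hr.ne'
      subst hst
      have : s = 0 := by
        by_contra hs0
        apply uinj a i j hij
        rw [lin a i s h, lin a j s h] at he
        have hc : (2 * (s : ℂ)) ≠ 0 := mul_ne_zero two_ne_zero (by exact_mod_cast hs0)
        exact mul_left_cancel₀ hc (add_left_cancel he)
      exact ⟨this, this⟩
    · exact (mixed a i j hij s hs t ht h h' he).elim
    · exact (mixed a j i hij.symm t ht s hs h' h he.symm).elim
    · rw [tail a i s h, tail a j t h'] at he
      have := hstar a i j hij _ (hτm a i s hs).1 _ (hτm a j t ht).1 he
      have := (hτm a i s hs).2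
      have := hs0 a i
      linarith
  · intro a i s hs he
    rcases le_total s (1 / 2) with h | h
    · have n1 := linnorm a i s hs h
      rw [he, sub_self, norm_zero] at n1
      have : s * r = 0 := by linarith
      rcases mul_eq_zero.mp this with h | h
      · exact h
      · exact absurd h hr.ne'
    · rw [tail a i s h, ← R.zero a i] at he
      have := R.inj a i (hτm a i s hs).1 (by simp) he
      have := (hτm a i s hs).2
      have := hs0 a i
      linarith
  · intro a b i hab s hs he
    rcases le_total s (1 / 2) with h | h
    · have n1 := linnorm a i s hs h
      rw [he] at n1
      have := hfar b a i hab.symm 0 (by simp)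
      rw [R.zero, n1] at this
      nlinarith
    · rw [tail a i s h] at he
      exact R.oth a b i hab _ (hτm a i s hs).1 he
  · rintro a b i j hab ⟨s, hs, t, ht, he⟩
    simp only at he
    rcases le_total s (1 / 2) with h | h <;> rcases le_total t (1 / 2) with h' | h'
    · exfalso
      have n1 := linnorm a i s hs h
      have n2 := linnorm b j t ht h'
      have := hfar b a i hab.symm 0 (by simp)
      rw [R.zero] at this
      have tri : ‖R.P b - R.P a‖ ≤ ‖η a i s - R.P a‖ + ‖η b j t - R.P b‖ := by
        rw [he]
        calc ‖R.P b - R.P a‖ = ‖(η b j t - R.P a) - (η b j t - R.P b)‖ := by congr 1; ring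
          _ ≤ _ := norm_sub_le _ _
      nlinarith
    · exfalso
      have n1 := linnorm a i s hs h
      rw [he, tail b j t h'] at n1
      have := hfar b a j hab.symm _ (hτm b j t ht).1
      nlinarith
    · exfalso
      have n1 := linnorm b j t ht h'
      rw [← he, tail a i s h] at n1
      have := hfar a b i hab _ (hτm a i s hs).1
      nlinarith
    · rw [tail a i s h, tail b j t h'] at he
      exact ⟨_, (hτm a i s hs).1, _, (hτm b j t ht).1, he⟩

end Raw
end K5n


namespace K5n
open Set

lemma adj_lr {m n : ℕ} (a : Fin m) (i : Fin n) : (bipK m n).Adj (Sum.inl a) (Sum.inr i) := by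
  simp

lemma fs_lt_sn (k : Fin 10) : fs k < sn k := by revert k; decide

lemma fs_sn_inj : ∀ k l : Fin 10, fs k = fs l → sn k = sn l → k = l := by decide

/-- The edge from `a` to `i`. -/
def ed {n : ℕ} (a : Fin 5) (i : Fin n) : Sym2 (Fin 5 ⊕ Fin n) := s(Sum.inl a, Sum.inr i)

lemma ed_inj {n : ℕ} {a b : Fin 5} {i j : Fin n} : ed a i = ed b j ↔ a = b ∧ i = j := by
  simp [ed]

lemma ed_mem {n : ℕ} (a : Fin 5) (i : Fin n) : ed a i ∈ (bipK 5 n).edgeSet := by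
  simp [ed]

lemma crossing_of_meet {n : ℕ} (D : Drawing (bipK 5 n)) {a b : Fin 5} {i j : Fin n}
    (hne : ed a i ≠ ed b j) {s t : ℝ} (hs : s ∈ Icc (0 : ℝ) 1) (ht : t ∈ Icc (0 : ℝ) 1)
    (h : D.arc (Sum.inl a) (Sum.inr i) s = D.arc (Sum.inl b) (Sum.inr j) t)
    (h1 : D.arc (Sum.inl a) (Sum.inr i) s ≠ D.pos (Sum.inl a))
    (h2 : D.arc (Sum.inl a) (Sum.inr i) s ≠ D.pos (Sum.inr i))
    (h3 : D.arc (Sum.inl a) (Sum.inr i) s ≠ D.pos (Sum.inl b))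
    (h4 : D.arc (Sum.inl a) (Sum.inr i) s ≠ D.pos (Sum.inr j)) :
    D.IsCrossing (ed a i) (ed b j) (D.arc (Sum.inl a) (Sum.inr i) s) := by
  refine ⟨ed_mem a i, ed_mem b j, hne, ⟨_, _, rfl, adj_lr a i, s, hs, rfl⟩,
    ⟨_, _, rfl, adj_lr b j, t, ht, h.symm⟩, ?_, ?_⟩
  · rintro ⟨c, hc, hp⟩
    rcases Sym2.mem_iff.mp hc with rfl | rfl
    · exact h1 hp
    · exact h2 hp
  · rintro ⟨c, hc, hp⟩
    rcases Sym2.mem_iff.mp hc with rfl | rfl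
    · exact h3 hp
    · exact h4 hp

lemma exists_raw {n : ℕ} (D : Drawing (bipK 5 n)) (hD : D.IsGood) :
    ∃ R : Raw (Fin n), ∀ a i t, R.γ a i t =
      Complex.equivRealProdCLM.symm (D.arc (Sum.inl a) (Sum.inr i) t) := by
  have hE : Function.Injective Complex.equivRealProdCLM.symm :=
    Complex.equivRealProdCLM.symm.injective
  refine ⟨{ P := fun a => Complex.equivRealProdCLM.symm (D.pos (Sum.inl a))
            Q := fun i => Complex.equivRealProdCLM.symm (D.pos (Sum.inr i))
            γ := fun a i t => Complex.equivRealProdCLM.symm (D.arc (Sum.inl a) (Sum.inr i) t)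
            cont := fun a i =>
              Complex.equivRealProdCLM.symm.continuous.comp_continuousOn (D.arc_cont (adj_lr a i))
            zero := fun a i => by rw [D.arc_zero (adj_lr a i)]
            one := fun a i => by rw [D.arc_one (adj_lr a i)]
            inj := fun a i => hE.comp_injOn (hD.arc_inj (adj_lr a i))
            star := ?_
            oth := ?_
            othQ := ?_ }, fun _ _ _ => rfl⟩
  · intro a i j hij s hs t ht h
    have h' := hE h
    by_contra hcon
    push Not at hcon
    have hp1 : D.arc (Sum.inl a) (Sum.inr i) s ≠ D.pos (Sum.inl a) := fun h => hcon.1 (by rw [h])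
    have hp2 : D.arc (Sum.inl a) (Sum.inr i) s ≠ D.pos (Sum.inr i) := fun h => hcon.2 (by rw [h])
    refine hD.adj_no_cross (ed a i) (ed a j) ⟨Sum.inl a, by simp [ed], by simp [ed]⟩ _
      (crossing_of_meet D (fun h => hij (ed_inj.mp h).2) hs ht h' hp1 hp2 hp1 ?_)
    intro h
    exact D.arc_avoid (adj_lr a i) (Sum.inr j) (by simp) (by simpa using Ne.symm hij) ⟨s, hs, h⟩
  · intro a b i hab s hs h
    exact D.arc_avoid (adj_lr a i) (Sum.inl b) (by simpa using Ne.symm hab) (by simp) ⟨s, hs, hE h⟩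
  · intro a i j hij s hs h
    exact D.arc_avoid (adj_lr a i) (Sum.inr j) (by simp) (by simpa using Ne.symm hij) ⟨s, hs, hE h⟩

lemma crossing_of_meet' {n : ℕ} (D : Drawing (bipK 5 n)) {a b : Fin 5} {i j : Fin n}
    (hab : a ≠ b) (hij : i ≠ j) {s t : ℝ} (hs : s ∈ Icc (0 : ℝ) 1) (ht : t ∈ Icc (0 : ℝ) 1)
    (h : D.arc (Sum.inl a) (Sum.inr i) s = D.arc (Sum.inl b) (Sum.inr j) t) :
    D.IsCrossing (ed a i) (ed b j) (D.arc (Sum.inl a) (Sum.inr i) s) := by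
  refine crossing_of_meet D (fun h => hij (ed_inj.mp h).2) hs ht h ?_ ?_ ?_ ?_
  · intro h'
    exact D.arc_avoid (adj_lr b j) (Sum.inl a) (by simpa using hab) (by simp)
      ⟨t, ht, h.symm.trans h'⟩
  · intro h'
    exact D.arc_avoid (adj_lr b j) (Sum.inr i) (by simp) (by simpa using hij)
      ⟨t, ht, h.symm.trans h'⟩
  · intro h'
    exact D.arc_avoid (adj_lr a i) (Sum.inl b) (by simpa using hab.symm) (by simp) ⟨s, hs, h'⟩
  · intro h'
    exact D.arc_avoid (adj_lr a i) (Sum.inr j) (by simp) (by simpa using hij.symm) ⟨s, hs, h'⟩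

lemma crossings_finite {V : Type*} [Finite V] {G : SimpleGraph V} (D : Drawing G) (hD : D.IsGood)
    (A B : Set (Sym2 V)) : Finite (D.crossings A B) := by
  have : Finite (Sym2 V) := Quot.finite _
  have : Finite (Sym2 (Sym2 V)) := Quot.finite _
  refine Finite.of_injective (fun q : D.crossings A B => q.1.2) ?_
  rintro ⟨⟨p, z⟩, e, f, h1, _, _, hc⟩ ⟨⟨p', z'⟩, e', f', h1', _, _, hc'⟩ hzz
  change z = z' at hzz
  subst hzz
  have : p = p' := by
    rw [h1] at h1'
    rcases Sym2.eq_iff.mp h1' with ⟨rfl, rfl⟩ | ⟨rfl, rfl⟩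
    · exact hD.cross_once _ _ hc hc'
    · refine hD.cross_once _ _ hc ?_
      obtain ⟨a1, a2, a3, a4, a5, a6, a7⟩ := hc'
      exact ⟨a2, a1, a3.symm, a5, a4, a7, a6⟩
  subst this
  rfl

lemma tot_eq {n : ℕ} (C : Fin n → Fin n → ℕ) (hs : ∀ i j, C i j = C j i) (h0 : ∀ i, C i i = 0) :
    totS C Finset.univ = 2 * ∑ i, ∑ j, if i < j then C i j else 0 := by
  have h1 : ∀ i j, C i j = (if i < j then C i j else 0) + (if j < i then C j i else 0) := by
    intro i j
    rcases lt_trichotomy i j with h | h | h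
    · simp [h, h.not_gt]
    · subst h; simp [h0]
    · simp [h, h.not_gt, hs i j]
  unfold totS rowS
  rw [Finset.sum_congr rfl fun i _ => Finset.sum_congr rfl fun j _ => h1 i j]
  simp only [Finset.sum_add_distrib]
  rw [Finset.sum_comm (f := fun i j => if j < i then C j i else 0), two_mul]

theorem lower {n : ℕ} (D : Drawing (bipK 5 n)) (hD : D.IsGood) : Z 5 n ≤ D.crNum := by
  obtain ⟨R, hR⟩ := exists_raw D hD
  obtain ⟨S, hS⟩ := R.straighten
  have hm := S.dat.main Finset.univ
  rw [tot_eq _ S.dat.C_symm S.dat.C_self, Finset.card_univ, Fintype.card_fin] at hm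
  have hZ : Z 5 n = 4 * (n / 2) * ((n - 1) / 2) := by simp [Z]
  rw [hZ]
  have hm' := Nat.le_of_mul_le_mul_left hm (by norm_num)
  refine hm'.trans ?_
  let F : Finset ((Fin n × Fin n) × Fin 10) :=
    Finset.univ.filter fun x => x.1.1 < x.1.2 ∧ S.dat.x x.2 x.1.1 x.1.2 = true
  have hF : (∑ i, ∑ j, if i < j then S.dat.C i j else 0) = F.card := by
    rw [Finset.card_filter, Fintype.sum_prod_type, Fintype.sum_prod_type]
    refine Finset.sum_congr rfl fun i _ => Finset.sum_congr rfl fun j _ => ?_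
    by_cases hij : i < j
    · simp only [hij, if_true, true_and, S.dat.C_ne hij.ne, wt]
      refine Finset.sum_congr rfl fun k _ => ?_
      cases S.dat.x k i j <;> simp
    · simp [hij]
  rw [hF]
  have hmeet : ∀ a b i j, a ≠ b → i ≠ j → S.Meet a b i j →
      ∃ p, D.IsCrossing (ed a i) (ed b j) p := by
    intro a b i j hab hij h
    obtain ⟨s, hs, t, ht, h⟩ := hS a b i j hab h
    rw [hR, hR] at h
    exact ⟨_, crossing_of_meet' D hab hij hs ht (Complex.equivRealProdCLM.symm.injective h)⟩
  have key : ∀ x : F, ∃ q : D.crossings (bipK 5 n).edgeSet (bipK 5 n).edgeSet,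
      q.1.2 = s(ed (fs x.1.2) x.1.1.1, ed (sn x.1.2) x.1.1.2) ∨
      q.1.2 = s(ed (fs x.1.2) x.1.1.2, ed (sn x.1.2) x.1.1.1) := by
    rintro ⟨⟨⟨i, j⟩, k⟩, hx⟩
    simp only [F, Finset.mem_filter, Finset.mem_univ, true_and] at hx
    obtain ⟨hij, hx⟩ := hx
    rcases S.meet_of_x k hij.ne hx with h | h
    · obtain ⟨p, hp⟩ := hmeet _ _ _ _ (fs_lt_sn k).ne hij.ne h
      exact ⟨⟨(p, s(_, _)), _, _, rfl, ed_mem _ _, ed_mem _ _, hp⟩, Or.inl rfl⟩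
    · obtain ⟨p, hp⟩ := hmeet _ _ _ _ (fs_lt_sn k).ne hij.ne' h
      exact ⟨⟨(p, s(_, _)), _, _, rfl, ed_mem _ _, ed_mem _ _, hp⟩, Or.inr rfl⟩
  choose g hg using key
  have := crossings_finite D hD (bipK 5 n).edgeSet (bipK 5 n).edgeSet
  have hinj : Function.Injective g := by
    rintro ⟨⟨⟨i, j⟩, k⟩, hx⟩ ⟨⟨⟨i', j'⟩, k'⟩, hx'⟩ h
    have e1 := hg ⟨⟨⟨i, j⟩, k⟩, hx⟩
    have e2 := hg ⟨⟨⟨i', j'⟩, k'⟩, hx'⟩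
    rw [← h] at e2
    simp only [F, Finset.mem_filter, Finset.mem_univ, true_and] at hx hx'
    have l1 := fs_lt_sn k
    have l2 := fs_lt_sn k'
    have l3 := hx.1
    have l4 := hx'.1
    simp only at e1 e2
    have hfin : fs k = fs k' ∧ sn k = sn k' ∧ i = i' ∧ j = j' := by
      rcases e1 with e1 | e1 <;> rcases e2 with e2 | e2 <;>
        (rw [e1] at e2; simp only [Sym2.eq_iff, ed_inj] at e2; omega)
    obtain ⟨h1, h2, rfl, rfl⟩ := hfin
    obtain rfl := fs_sn_inj _ _ h1 h2
    rfl
  have := Nat.card_le_card_of_injective g hinj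
  rwa [Nat.card_eq_fintype_card, Fintype.card_coe] at this

end K5n


namespace K5n
open Set

/-- Rational part of the dual abscissa. -/
def pu : Fin 5 → ℤ := ![1, 2, 1, -1, -2]
/-- Irrational part of the dual abscissa. -/
def pv : Fin 5 → ℤ := ![0, 0, 1, 0, 0]
/-- Dual abscissa. -/
noncomputable def pp (a : Fin 5) : ℝ := pu a + pv a * √2
/-- Dual ordinate. -/
def qq (i : ℕ) : ℤ := if i % 2 = 0 then (i : ℤ) + 1 else -((i : ℤ) + 1)

/-- Positions in the Zarankiewicz drawing. -/
noncomputable def zpos {n : ℕ} : Fin 5 ⊕ Fin n → ℝ × ℝ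
  | Sum.inl a => ((pp a)⁻¹, 0)
  | Sum.inr i => (0, (qq i : ℝ)⁻¹)

lemma irr_comb {A B : ℤ} (h : (A : ℝ) + B * √2 = 0) : A = 0 ∧ B = 0 := by
  have hB : B = 0 := by
    by_contra hB
    have hB' : (B : ℝ) ≠ 0 := by exact_mod_cast hB
    refine irrational_sqrt_two ⟨-(A : ℚ) / B, ?_⟩
    push_cast
    rw [div_eq_iff hB']
    linarith
  subst hB
  simp at h
  exact ⟨h, rfl⟩

lemma pp_inj {a b : Fin 5} (h : pp a = pp b) : a = b := by
  have h2 : ((pu a - pu b : ℤ) : ℝ) + ((pv a - pv b : ℤ) : ℝ) * √2 = 0 := by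
    unfold pp at h
    push_cast
    linarith
  have h3 := irr_comb h2
  clear h h2
  revert a b
  decide

lemma pp_sign (a : Fin 5) : (a < 3 ∧ 0 < pp a) ∨ (3 ≤ a ∧ pp a < 0) := by
  have h2 : 0 < √2 := by positivity
  fin_cases a <;> simp [pp, pu, pv] <;> first | decide | (try positivity)

lemma pp_ne (a : Fin 5) : pp a ≠ 0 := by
  rcases pp_sign a with h | h
  · exact h.2.ne'
  · exact h.2.ne

/-- Orientation of same side pairs. -/
lemma pp_order {a b : Fin 5} (hX : ∃ X : ℝ, 0 < pp a * X ∧ 0 < pp b * X ∧ 0 < (pp a - pp b) * X) :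
    b < a ∧ (a < 3 ↔ b < 3) := by
  obtain ⟨X, h1, h2, h3⟩ := hX
  have hs : 1 < √2 := by
    rw [Real.lt_sqrt] <;> norm_num
  have hX : X ≠ 0 := by rintro rfl; simp at h1
  rcases lt_or_gt_of_ne hX with hX | hX
  · have g1 : pp a < 0 := by by_contra! h; nlinarith
    have g2 : pp b < 0 := by by_contra! h; nlinarith
    have g3 : pp a < pp b := by by_contra! h; nlinarith
    fin_cases a <;> fin_cases b <;> simp [pp, pu, pv] at g1 g2 g3 ⊢ <;> linarith
  · have g1 : 0 < pp a := by by_contra! h; nlinarith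
    have g2 : 0 < pp b := by by_contra! h; nlinarith
    have g3 : pp b < pp a := by by_contra! h; nlinarith
    fin_cases a <;> fin_cases b <;> simp [pp, pu, pv] at g1 g2 g3 ⊢ <;> linarith

lemma qq_inj {i j : ℕ} (h : qq i = qq j) : i = j := by
  unfold qq at h
  split_ifs at h <;> omega

lemma qq_ne (i : ℕ) : qq i ≠ 0 := by
  unfold qq; split_ifs <;> omega

lemma qq_ne' (i : ℕ) : (qq i : ℝ) ≠ 0 := by exact_mod_cast qq_ne i

lemma qq_same {i j : ℕ} {Y : ℝ} (h1 : 0 < qq i * Y) (h2 : 0 < qq j * Y) : i % 2 = j % 2 := by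
  have h3 : (0 : ℝ) < (qq i * qq j : ℤ) := by
    push_cast
    have hY : 0 < Y ^ 2 := by
      have : Y ≠ 0 := by rintro rfl; simp at h1
      positivity
    by_contra! h
    nlinarith [mul_pos h1 h2]
  have h4 : 0 < qq i * qq j := by exact_mod_cast h3
  unfold qq at h4
  split_ifs at h4 with a b b <;> first | omega | (exfalso; nlinarith)

lemma qq_order {i j : ℕ} (hij : i < j) {Y : ℝ} (h1 : 0 < qq i * Y) (h2 : 0 < qq j * Y) :
    0 < ((qq j : ℝ) - qq i) * Y := by
  have hp := qq_same h1 h2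
  have hij' : (i : ℝ) < j := by exact_mod_cast hij
  have hi : (0 : ℝ) ≤ i := by positivity
  unfold qq at h1 h2 ⊢
  rw [← hp] at h2 ⊢
  split_ifs at h1 h2 ⊢ with h
  · push_cast at *
    have : 0 < Y := by by_contra! h; nlinarith
    nlinarith
  · push_cast at *
    have : Y < 0 := by by_contra! h; nlinarith
    nlinarith

lemma lm (p q : ℝ × ℝ) (t : ℝ) : AffineMap.lineMap p q t =
    ((1 - t) * p.1 + t * q.1, (1 - t) * p.2 + t * q.2) := by
  simp [AffineMap.lineMap_apply_module, Prod.ext_iff]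

lemma zpos_inj {n : ℕ} : Function.Injective (zpos (n := n)) := by
  rintro (a | i) (b | j) h <;> simp only [zpos, Prod.mk.injEq] at h
  · rw [pp_inj (inv_injective h.1)]
  · exact absurd h.1 (inv_ne_zero (pp_ne a))
  · exact absurd h.1.symm (inv_ne_zero (pp_ne b))
  · have := inv_injective h.2
    exact congrArg Sum.inr (Fin.ext (qq_inj (by exact_mod_cast this)))

lemma zavoid {n : ℕ} (a : Fin 5) (i : Fin n) (c : Fin 5 ⊕ Fin n) (t : ℝ)
    (h : AffineMap.lineMap (zpos (n := n) (Sum.inl a)) (zpos (Sum.inr i)) t = zpos c) :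
    c = Sum.inl a ∨ c = Sum.inr i := by
  rw [lm] at h
  rcases c with b | j <;> simp only [zpos, Prod.mk.injEq, mul_zero, add_zero, zero_add] at h
  · left
    have ht : t = 0 := by
      rcases mul_eq_zero.mp h.2 with h | h
      · exact h
      · exact absurd h (inv_ne_zero (qq_ne' i))
    rw [ht] at h
    have h1 : (pp a)⁻¹ = (pp b)⁻¹ := by linarith [h.1]
    rw [pp_inj (inv_injective h1)]
  · right
    have ht : 1 - t = 0 := by
      rcases mul_eq_zero.mp h.1 with h | h
      · exact h
      · exact absurd h (inv_ne_zero (pp_ne a))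
    have ht : t = 1 := by linarith
    rw [ht, one_mul] at h
    have h1 := inv_injective h.2
    exact congrArg Sum.inr (Fin.ext (qq_inj (by exact_mod_cast h1.symm)))

/-- The Zarankiewicz drawing. -/
noncomputable def zdraw (n : ℕ) : Drawing (bipK 5 n) where
  pos := zpos
  pos_inj := zpos_inj
  arc u v := fun t => AffineMap.lineMap (zpos u) (zpos v) t
  arc_cont := fun u v _ => by
    simp only [lm]
    fun_prop
  arc_zero := fun u v _ => by simp
  arc_one := fun u v _ => by simp
  arc_symm := fun u v _ t => by rw [AffineMap.lineMap_apply_one_sub]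
  arc_avoid := by
    rintro (a | i) (b | j) hadj c h1 h2 ⟨t, -, ht⟩
    · simp at hadj
    · rcases zavoid a j c t ht with h | h
      · exact h1 h
      · exact h2 h
    · simp only at ht
      rw [← AffineMap.lineMap_apply_one_sub] at ht
      rcases zavoid b i c _ ht with h | h
      · exact h2 h
      · exact h1 h
    · simp at hadj

/-- `p` is interior to edge `a i`. -/
def On {n : ℕ} (a : Fin 5) (i : Fin n) (p : ℝ × ℝ) : Prop :=
  0 < pp a * p.1 ∧ 0 < qq i * p.2 ∧ pp a * p.1 + qq i * p.2 = 1

lemma edge_ed {n : ℕ} {e : Sym2 (Fin 5 ⊕ Fin n)} (h : e ∈ (bipK 5 n).edgeSet) :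
    ∃ a i, e = ed a i := by
  induction e using Sym2.ind with
  | _ u v =>
    rcases u with a | i <;> rcases v with b | j
    · simp at h
    · exact ⟨a, j, rfl⟩
    · exact ⟨b, i, Sym2.eq_swap⟩
    · simp at h

lemma on_of {n : ℕ} {a : Fin 5} {i : Fin n} {p : ℝ × ℝ} (h : p ∈ (zdraw n).edgePoints (ed a i))
    (h' : p ∉ (zdraw n).ends (ed a i)) : On a i p := by
  have hp : ∃ t ∈ Icc (0 : ℝ) 1,
      p = AffineMap.lineMap (zpos (n := n) (Sum.inl a)) (zpos (Sum.inr i)) t := by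
    obtain ⟨u, v, he, -, t, ht, rfl⟩ := h
    rcases Sym2.eq_iff.mp he with ⟨rfl, rfl⟩ | ⟨rfl, rfl⟩
    · exact ⟨t, ht, rfl⟩
    · refine ⟨1 - t, ⟨by linarith [ht.2], by linarith [ht.1]⟩, ?_⟩
      rw [AffineMap.lineMap_apply_one_sub]
      rfl
  obtain ⟨t, ht, rfl⟩ := hp
  have h0 : t ≠ 0 := by
    rintro rfl
    exact h' ⟨Sum.inl a, by simp [ed], by simp [zdraw]⟩
  have h1 : t ≠ 1 := by
    rintro rfl
    exact h' ⟨Sum.inr i, by simp [ed], by simp [zdraw]⟩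
  have ht0 : 0 < t := lt_of_le_of_ne ht.1 (Ne.symm h0)
  have ht1 : t < 1 := lt_of_le_of_ne ht.2 h1
  have e1 : pp a * ((1 - t) * (pp a)⁻¹) = 1 - t := by
    have := pp_ne a
    field_simp
  have e2 : (qq i : ℝ) * (t * (qq i : ℝ)⁻¹) = t := by
    have := qq_ne' i
    field_simp
  rw [lm]
  simp only [On, zpos, mul_zero, add_zero, zero_add]
  rw [e1, e2]
  exact ⟨by linarith, ht0, by ring⟩

lemma cross_on {n : ℕ} {a b : Fin 5} {i j : Fin n} {p : ℝ × ℝ}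
    (h : (zdraw n).IsCrossing (ed a i) (ed b j) p) : On a i p ∧ On b j p :=
  ⟨on_of h.2.2.2.1 h.2.2.2.2.2.1, on_of h.2.2.2.2.1 h.2.2.2.2.2.2⟩

lemma on_ne {n : ℕ} {a b : Fin 5} {i j : Fin n} {p : ℝ × ℝ} (h1 : On a i p) (h2 : On b j p) :
    a = b ↔ i = j := by
  have hX : p.1 ≠ 0 := by intro h; have := h1.1; rw [h] at this; simp at this
  have hY : p.2 ≠ 0 := by intro h; have := h1.2.1; rw [h] at this; simp at this
  have e1 := h1.2.2
  have e2 := h2.2.2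
  constructor
  · rintro rfl
    have : (qq i : ℝ) = qq j := mul_right_cancel₀ hY (by linarith)
    exact Fin.ext (qq_inj (by exact_mod_cast this))
  · rintro rfl
    exact pp_inj (mul_right_cancel₀ hX (by linarith))

lemma cross_ne {n : ℕ} {a b : Fin 5} {i j : Fin n} {p : ℝ × ℝ}
    (h : (zdraw n).IsCrossing (ed a i) (ed b j) p) : a ≠ b ∧ i ≠ j := by
  have := on_ne (cross_on h).1 (cross_on h).2
  have hne := h.2.2.1
  rw [Ne, ed_inj] at hne
  tauto

lemma tri_det : ∀ a b c : Fin 5, a ≠ b → a ≠ c → b ≠ c → (a < 3 ↔ b < 3) → (a < 3 ↔ c < 3) →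
    (pu a - pu b) * (pv a - pv c) - (pu a - pu c) * (pv a - pv b) ≠ 0 := by decide

lemma side {n : ℕ} {a b : Fin 5} {i j : Fin n} {p : ℝ × ℝ} (h1 : On a i p) (h2 : On b j p) :
    a < 3 ↔ b < 3 := by
  have g1 := h1.1
  have g2 := h2.1
  rcases pp_sign a with ha | ha <;> rcases pp_sign b with hb | hb
  · exact ⟨fun _ => hb.1, fun _ => ha.1⟩
  · exfalso
    rcases le_total p.1 0 with h | h <;> nlinarith [ha.2, hb.2]
  · exfalso
    rcases le_total p.1 0 with h | h <;> nlinarith [ha.2, hb.2]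
  · exact ⟨fun h => absurd h ha.1.not_gt, fun h => absurd h hb.1.not_gt⟩

lemma zgood (n : ℕ) : (zdraw n).IsGood where
  arc_inj := by
    intro u v hadj s _ t _ h
    exact AffineMap.lineMap_injective ℝ (zpos_inj.ne hadj.ne) h
  adj_no_cross := by
    rintro e f ⟨v, hv1, hv2⟩ p h
    obtain ⟨a, i, rfl⟩ := edge_ed h.1
    obtain ⟨b, j, rfl⟩ := edge_ed h.2.1
    have := cross_ne h
    rcases Sym2.mem_iff.mp hv1 with rfl | rfl <;> rcases Sym2.mem_iff.mp hv2 with h | h <;>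
      simp at h <;> tauto
  cross_once := by
    intro e f p h p' h'
    change (zdraw n).IsCrossing e f p at h
    change (zdraw n).IsCrossing e f p' at h'
    obtain ⟨a, i, rfl⟩ := edge_ed h.1
    obtain ⟨b, j, rfl⟩ := edge_ed h.2.1
    have hij := (cross_ne h).2
    obtain ⟨h1, h2⟩ := cross_on h
    obtain ⟨h1', h2'⟩ := cross_on h'
    have e1 := h1.2.2
    have e2 := h2.2.2
    have e1' := h1'.2.2
    have e2' := h2'.2.2
    have d1 : (pp a * qq j - pp b * qq i) * p.1 = qq j - qq i := by
      linear_combination (qq j : ℝ) * e1 - (qq i : ℝ) * e2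
    have d1' : (pp a * qq j - pp b * qq i) * p'.1 = qq j - qq i := by
      linear_combination (qq j : ℝ) * e1' - (qq i : ℝ) * e2'
    have d2 : (pp a * qq j - pp b * qq i) * p.2 = pp a - pp b := by
      linear_combination (pp a : ℝ) * e2 - (pp b : ℝ) * e1
    have d2' : (pp a * qq j - pp b * qq i) * p'.2 = pp a - pp b := by
      linear_combination (pp a : ℝ) * e2' - (pp b : ℝ) * e1'
    have hdet : pp a * qq j - pp b * qq i ≠ 0 := by
      intro h0
      rw [h0, zero_mul] at d1
      have : (qq i : ℝ) = qq j := by linarith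
      exact hij (Fin.ext (qq_inj (by exact_mod_cast this)))
    exact Prod.ext (mul_left_cancel₀ hdet (d1.trans d1'.symm))
      (mul_left_cancel₀ hdet (d2.trans d2'.symm))
  no_triple := by
    rintro p e f g - - - ⟨h1, h2, h3⟩
    obtain ⟨a, i, rfl⟩ := edge_ed h1.1
    obtain ⟨b, j, rfl⟩ := edge_ed h1.2.1
    obtain ⟨c, k, rfl⟩ := edge_ed h2.2.1
    have n1 := cross_ne h1
    have n2 := cross_ne h2
    have n3 := cross_ne h3
    obtain ⟨oa, ob⟩ := cross_on h1
    obtain ⟨-, oc⟩ := cross_on h2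
    have hdet := tri_det a b c n1.1 n3.1 n2.1 (side oa ob) (side oa oc)
    have hX : p.1 ≠ 0 := by intro h; have := oa.1; rw [h] at this; simp at this
    have hY : p.2 ≠ 0 := by intro h; have := oa.2.1; rw [h] at this; simp at this
    have ea := oa.2.2
    have eb := ob.2.2
    have ec := oc.2.2
    have hc : (pp a - pp b) * (qq k - qq i) - (pp a - pp c) * (qq j - qq i) = 0 := by
      refine mul_right_cancel₀ hX ?_
      linear_combination ((qq k : ℝ) - qq i) * (ea - eb) - ((qq j : ℝ) - qq i) * (ea - ec)
    have hc' : (((pu a - pu b) * (qq k - qq i) - (pu a - pu c) * (qq j - qq i) : ℤ) : ℝ) +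
        (((pv a - pv b) * (qq k - qq i) - (pv a - pv c) * (qq j - qq i) : ℤ) : ℝ) * √2 = 0 := by
      unfold pp at hc
      push_cast
      linear_combination hc
    obtain ⟨z1, z2⟩ := irr_comb hc'
    have hM : ((pu a - pu b) * (pv a - pv c) - (pu a - pu c) * (pv a - pv b)) *
        (qq k - qq i) = 0 := by
      linear_combination (pv a - pv c) * z1 - (pu a - pu c) * z2
    rcases mul_eq_zero.mp hM with h | h
    · exact hdet h
    · exact n3.2 (Fin.ext (qq_inj (by linarith)))

/-- The index set for crossings. -/
def TT (n : ℕ) : Finset ((Fin 5 × Fin 5) × (Σ _ : ℕ, ℕ)) :=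
  (Finset.univ.filter fun x : Fin 5 × Fin 5 => x.2 < x.1 ∧ (x.1 < 3 ↔ x.2 < 3)) ×ˢ
    ((Finset.range n).sigma fun j => Finset.range (j / 2))

lemma sum_half (n : ℕ) : ∑ j ∈ Finset.range n, j / 2 = n / 2 * ((n - 1) / 2) := by
  induction n with
  | zero => simp
  | succ n ih =>
    rw [Finset.sum_range_succ, ih]
    obtain ⟨m, rfl | rfl⟩ : ∃ m, n = 2 * m ∨ n = 2 * m + 1 := ⟨n / 2, by omega⟩
    · rcases m with _ | m
      · simp
      · have h1 : 2 * (m + 1) / 2 = m + 1 := by omega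
        have h2 : (2 * (m + 1) - 1) / 2 = m := by omega
        have h3 : (2 * (m + 1) + 1) / 2 = m + 1 := by omega
        have h4 : (2 * (m + 1) + 1 - 1) / 2 = m + 1 := by omega
        rw [h1, h2, h3, h4]; ring
    · have h1 : (2 * m + 1) / 2 = m := by omega
      have h2 : (2 * m + 1 - 1) / 2 = m := by omega
      have h3 : (2 * m + 1 + 1) / 2 = m + 1 := by omega
      have h4 : (2 * m + 1 + 1 - 1) / 2 = m := by omega
      rw [h1, h2, h3, h4]; ring

lemma TT_card (n : ℕ) : (TT n).card = Z 5 n := by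
  unfold TT
  rw [Finset.card_product, Finset.card_sigma]
  simp only [Finset.card_range]
  rw [sum_half]
  have : (Finset.univ.filter fun x : Fin 5 × Fin 5 => x.2 < x.1 ∧ (x.1 < 3 ↔ x.2 < 3)).card = 4 := by
    decide
  rw [this]
  simp [Z, mul_assoc]

lemma cross_TT {n : ℕ} {a b : Fin 5} {i j : Fin n} {p : ℝ × ℝ} (hij : i < j)
    (h : (zdraw n).IsCrossing (ed a i) (ed b j) p) :
    ((a, b), (⟨(j : ℕ), (i : ℕ) / 2⟩ : Σ _ : ℕ, ℕ)) ∈ TT n ∧ (i : ℕ) % 2 = (j : ℕ) % 2 := by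
  obtain ⟨h1, h2⟩ := cross_on h
  have hpar := qq_same h1.2.1 h2.2.1
  have hord := qq_order (show (i : ℕ) < j from hij) h1.2.1 h2.2.1
  have e1 := h1.2.2
  have e2 := h2.2.2
  have hp := pp_order ⟨p.1, h1.1, h2.1, by linarith⟩
  refine ⟨?_, hpar⟩
  have hij' : (i : ℕ) < j := hij
  simp only [TT, Finset.mem_product, Finset.mem_filter, Finset.mem_univ, true_and,
    Finset.mem_sigma, Finset.mem_range]
  exact ⟨hp, j.2, by omega⟩

lemma upper (n : ℕ) : (zdraw n).crNum ≤ Z 5 n := by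
  have key : ∀ q : (zdraw n).crossings (bipK 5 n).edgeSet (bipK 5 n).edgeSet,
      ∃ (a b : Fin 5) (i j : Fin n), i < j ∧ q.1.2 = s(ed a i, ed b j) ∧
        (zdraw n).IsCrossing (ed a i) (ed b j) q.1.1 := by
    rintro ⟨⟨p, z⟩, e, f, hz, -, -, hc⟩
    obtain ⟨a, i, rfl⟩ := edge_ed hc.1
    obtain ⟨b, j, rfl⟩ := edge_ed hc.2.1
    rcases lt_or_gt_of_ne (cross_ne hc).2 with h | h
    · exact ⟨a, b, i, j, h, hz, hc⟩
    · refine ⟨b, a, j, i, h, hz.trans Sym2.eq_swap, ?_⟩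
      obtain ⟨a1, a2, a3, a4, a5, a6, a7⟩ := hc
      exact ⟨a2, a1, a3.symm, a5, a4, a7, a6⟩
  choose a b i j hij hz hc using key
  let g : (zdraw n).crossings (bipK 5 n).edgeSet (bipK 5 n).edgeSet → TT n :=
    fun q => ⟨_, (cross_TT (hij q) (hc q)).1⟩
  have hg : Function.Injective g := by
    intro q q' h
    have h' := congrArg Subtype.val h
    simp only [g, Prod.mk.injEq, Sigma.mk.injEq, heq_eq_eq] at h'
    obtain ⟨⟨h1, h2⟩, h3, h4⟩ := h'
    have m1 := (cross_TT (hij q) (hc q)).2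
    have m2 := (cross_TT (hij q') (hc q')).2
    have h5 : i q = i q' := Fin.ext (by omega)
    have h6 : j q = j q' := Fin.ext h3
    have c1 := hc q
    have c2 := hc q'
    rw [← h1, ← h2, ← h5, ← h6] at c2
    apply Subtype.ext
    refine Prod.ext ((zgood n).cross_once _ _ c1 c2) ?_
    rw [hz q, hz q', h1, h2, h5, h6]
  have := Nat.card_le_card_of_injective g hg
  rw [Nat.card_eq_fintype_card (α := TT n), Fintype.card_coe, TT_card] at this
  exact this

end K5n

theorem statement12 (n : ℕ) (hn : 0 < n) :
    crossingNumber (bipK 5 n) = Z 5 n := by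
  have hmem : (K5n.zdraw n).crNum ∈ {m | ∃ D : Drawing (bipK 5 n), D.IsGood ∧ D.crNum = m} :=
    ⟨K5n.zdraw n, K5n.zgood n, rfl⟩
  apply le_antisymm
  · exact (Nat.sInf_le hmem).trans (K5n.upper n)
  · obtain ⟨D, hD, h⟩ := Nat.sInf_mem (s := {m | ∃ D : Drawing (bipK 5 n), D.IsGood ∧ D.crNum = m})
      ⟨_, hmem⟩
    unfold crossingNumber
    rw [← h]
    exact K5n.lower D hD
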